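/- Let n ≥ 2, q ≥ 0 and p ∈ ℝ, and suppose the weak Liouville property holds for (p,q) in dimension n. Then there exists a constant C = C(n,p,q) > 0 such that for every domain Ω ⊊ ℝ^n with nonempty boundary and every positive classical solution u of Δu + |∇u|^q u^p = 0 on Ω, one has (|∇u(x)|²/u(x)² + |∇u(x)|^q u(x)^{p−1}) ≤ C / dist(x, ∂Ω)² for every x ∈ Ω. -/

import Mathlib

open scoped BigOperators

/-- The Euclidean Laplacian of `u : ℝⁿ → ℝ`, defined as the sum of the second
partial derivatives in the coordinate directions. -/
noncomputable def elaplacian {n : ℕ} (u : EuclideanSpace ℝ (Fin n) → ℝ)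
    (x : EuclideanSpace ℝ (Fin n)) : ℝ :=
  ∑ i : Fin n, fderiv ℝ (fun y => fderiv ℝ u y (EuclideanSpace.single i 1)) x
    (EuclideanSpace.single i 1)

namespace WeakLiouville

open Set Filter Topology MeasureTheory
open scoped ContDiff

/-- Euclidean space of dimension `n`. -/
abbrev E (n : ℕ) := EuclideanSpace ℝ (Fin n)

variable {n : ℕ}

/-- The partial derivative in the `i`-th coordinate direction. -/
noncomputable def pd (i : Fin n) (u : E n → ℝ) (x : E n) : ℝ :=
  fderiv ℝ u x (EuclideanSpace.single i 1)

lemma elaplacian_eq_sum_pd (u : E n → ℝ) (x : E n) :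
    elaplacian u x = ∑ i, pd i (pd i u) x := rfl

lemma pd_congr {u w : E n → ℝ} {x : E n} (h : u =ᶠ[𝓝 x] w) (i : Fin n) :
    pd i u =ᶠ[𝓝 x] pd i w := by
  filter_upwards [h.fderiv (𝕜 := ℝ)] with y hy
  simp [pd, hy]

lemma elaplacian_congr {u w : E n → ℝ} {x : E n} (h : u =ᶠ[𝓝 x] w) :
    elaplacian u x = elaplacian w x := by
  simp only [elaplacian_eq_sum_pd]
  exact Finset.sum_congr rfl fun i _ => (pd_congr (pd_congr h i) i).eq_of_nhds

lemma contDiffAt_pd {m k : WithTop ℕ∞} {u : E n → ℝ} {x : E n} (hu : ContDiffAt ℝ k u x)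
    (hm : m + 1 ≤ k) (i : Fin n) : ContDiffAt ℝ m (pd i u) x :=
  (hu.fderiv_right hm).clm_apply contDiffAt_const

lemma contDiff_pd {m k : WithTop ℕ∞} {u : E n → ℝ} (hu : ContDiff ℝ k u)
    (hm : m + 1 ≤ k) (i : Fin n) : ContDiff ℝ m (pd i u) :=
  contDiff_iff_contDiffAt.2 fun _ => contDiffAt_pd hu.contDiffAt hm i

lemma continuous_pd {u : E n → ℝ} (hu : ContDiff ℝ 1 u) (i : Fin n) : Continuous (pd i u) :=
  (contDiff_pd (m := 0) hu (by simp) i).continuous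

lemma contDiff_pd_one {u : E n → ℝ} (hu : ContDiff ℝ 2 u) (i : Fin n) : ContDiff ℝ 1 (pd i u) :=
  contDiff_pd hu (by norm_num) i

lemma continuous_elaplacian {u : E n → ℝ} (hu : ContDiff ℝ 2 u) : Continuous (elaplacian u) :=
  continuous_finsetSum _ fun i _ => continuous_pd (contDiff_pd_one hu i) i

lemma eq_sum_single (v : E n) : v = ∑ i, v i • EuclideanSpace.single i (1 : ℝ) := by
  ext j
  simp [Finset.sum_apply, Pi.single_apply]

lemma fderiv_apply_eq_sum (u : E n → ℝ) (x v : E n) :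
    fderiv ℝ u x v = ∑ i, v i * pd i u x := by
  conv_lhs => rw [eq_sum_single v]
  simp [pd]

lemma gradient_apply (u : E n → ℝ) (x : E n) (i : Fin n) : gradient u x i = pd i u x := by
  have h : inner ℝ (gradient u x) (EuclideanSpace.single i (1 : ℝ)) = pd i u x := by
    simp [gradient, pd]
  rw [← h, EuclideanSpace.inner_single_right]
  simp

lemma norm_gradient_sq (u : E n → ℝ) (x : E n) : ‖gradient u x‖ ^ 2 = ∑ i, pd i u x ^ 2 := by
  rw [EuclideanSpace.norm_sq_eq]
  simp [gradient_apply]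

lemma norm_gradient_eq_sqrt (u : E n → ℝ) (x : E n) :
    ‖gradient u x‖ = √(∑ i, pd i u x ^ 2) := by
  rw [← norm_gradient_sq, Real.sqrt_sq (norm_nonneg _)]

lemma norm_gradient_eq (u : E n → ℝ) (x : E n) : ‖gradient u x‖ = ‖fderiv ℝ u x‖ := by
  simp [gradient]

lemma abs_pd_le (u : E n → ℝ) (x : E n) (i : Fin n) : |pd i u x| ≤ ‖gradient u x‖ := by
  rw [← gradient_apply]
  exact PiLp.norm_apply_le (gradient u x) i

lemma norm_gradient_congr {u w : E n → ℝ} {x : E n} (h : u =ᶠ[𝓝 x] w) :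
    ‖gradient u x‖ = ‖gradient w x‖ := by
  simp only [norm_gradient_eq_sqrt, (pd_congr h _).eq_of_nhds]

lemma continuousAt_norm_gradient {u : E n → ℝ} {x : E n} (hu : ContDiffAt ℝ 1 u x) :
    ContinuousAt (fun y => ‖gradient u y‖) x := by
  simp only [norm_gradient_eq]
  exact (hu.fderiv_right (m := 0) (by simp)).continuousAt.norm

lemma pd_comm {u : E n → ℝ} (hu : ContDiff ℝ 2 u) (i j : Fin n) (x : E n) :
    pd i (pd j u) x = pd j (pd i u) x := by
  have hd : DifferentiableAt ℝ (fderiv ℝ u) x :=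
    (hu.fderiv_right (m := 1) (by norm_num)).differentiable (by norm_num) x
  have h (a b : Fin n) : pd a (pd b u) x =
      fderiv ℝ (fderiv ℝ u) x (EuclideanSpace.single a 1) (EuclideanSpace.single b 1) := by
    change fderiv ℝ (fun y => fderiv ℝ u y (EuclideanSpace.single b 1)) x _ = _
    rw [fderiv_clm_apply hd (differentiableAt_const _)]
    simp
  rw [h, h]
  exact (hu.contDiffAt.isSymmSndFDerivAt (by simp)) _ _

lemma pd_comp_affine (u : E n → ℝ) (s c μ : ℝ) (x₀ x : E n) (i : Fin n) :
    pd i (fun y => s * (u (x₀ + μ • y) - c)) x = s * μ * pd i u (x₀ + μ • x) := by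
  have h1 : fderiv ℝ (fun y => s * (u (x₀ + μ • y) - c)) x
      = s • fderiv ℝ (fun y => u (x₀ + μ • y)) x := by
    have := congrFun (fderiv_const_smul_field (𝕜 := ℝ) (R := ℝ) s
      (f := fun y => u (x₀ + μ • y) - c)) x
    simpa [fderiv_sub_const, Pi.smul_def] using this
  have h2 : fderiv ℝ (fun y => u (x₀ + μ • y)) x = μ • fderiv ℝ u (x₀ + μ • x) := by
    rw [fderiv_comp_smul (f := fun y => u (x₀ + y)) μ, fderiv_comp_add_left]
  simp [pd, h1, h2, mul_assoc]

lemma elaplacian_comp_affine (u : E n → ℝ) (s c μ : ℝ) (x₀ x : E n) :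
    elaplacian (fun y => s * (u (x₀ + μ • y) - c)) x
      = s * μ ^ 2 * elaplacian u (x₀ + μ • x) := by
  simp only [elaplacian_eq_sum_pd, Finset.mul_sum]
  refine Finset.sum_congr rfl fun i _ => ?_
  have h : pd i (fun y => s * (u (x₀ + μ • y) - c))
      = fun y => (s * μ) * (pd i u (x₀ + μ • y) - 0) := by
    ext y
    rw [pd_comp_affine, sub_zero]
  rw [h, pd_comp_affine]
  ring

lemma norm_gradient_comp_affine (u : E n → ℝ) (s c μ : ℝ) (x₀ x : E n) :
    ‖gradient (fun y => s * (u (x₀ + μ • y) - c)) x‖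
      = |s * μ| * ‖gradient u (x₀ + μ • x)‖ := by
  have h : gradient (fun y => s * (u (x₀ + μ • y) - c)) x
      = (s * μ) • gradient u (x₀ + μ • x) := by
    ext i
    simp [gradient_apply, pd_comp_affine]
  rw [h, norm_smul, Real.norm_eq_abs]

lemma pd_add {u w : E n → ℝ} {x : E n} (hu : DifferentiableAt ℝ u x)
    (hw : DifferentiableAt ℝ w x) (i : Fin n) :
    pd i (fun y => u y + w y) x = pd i u x + pd i w x := by
  simp [pd, fderiv_fun_add hu hw]

lemma pd_const_mul {u : E n → ℝ} {x : E n} (hu : DifferentiableAt ℝ u x) (c : ℝ) (i : Fin n) :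
    pd i (fun y => c * u y) x = c * pd i u x := by
  simp [pd, fderiv_const_mul hu]

lemma pd_mul {u w : E n → ℝ} {x : E n} (hu : DifferentiableAt ℝ u x)
    (hw : DifferentiableAt ℝ w x) (i : Fin n) :
    pd i (fun y => u y * w y) x = u x * pd i w x + pd i u x * w x := by
  simp [pd, fderiv_fun_mul hu hw, mul_comm]

lemma pd_sum {ι : Type*} {s : Finset ι} {u : ι → E n → ℝ} {x : E n}
    (hu : ∀ l ∈ s, DifferentiableAt ℝ (u l) x) (i : Fin n) :
    pd i (fun y => ∑ l ∈ s, u l y) x = ∑ l ∈ s, pd i (u l) x := by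
  simp [pd, fderiv_fun_sum hu]

lemma pd_coord (i l : Fin n) (x : E n) :
    pd i (fun y : E n => y l) x = if l = i then 1 else 0 := by
  have : HasFDerivAt (fun y : E n => y l) (EuclideanSpace.proj (𝕜 := ℝ) l : E n →L[ℝ] ℝ) x :=
    (EuclideanSpace.proj (𝕜 := ℝ) l : E n →L[ℝ] ℝ).hasFDerivAt
  simp [pd, this.fderiv]

lemma contDiff_coord {m : WithTop ℕ∞} (l : Fin n) : ContDiff ℝ m (fun y : E n => y l) :=
  (EuclideanSpace.proj (𝕜 := ℝ) l : E n →L[ℝ] ℝ).contDiff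

/-- Smooth kernels supported in the closed unit ball. -/
structure IsKernel (K : E n → ℝ) : Prop where
  smooth : ContDiff ℝ ∞ K
  supp : tsupport K ⊆ Metric.closedBall 0 1

namespace IsKernel

variable {K : E n → ℝ}

lemma hasCompactSupport (hK : IsKernel K) : HasCompactSupport K :=
  (isCompact_closedBall (0 : E n) 1).of_isClosed_subset (isClosed_tsupport K) hK.supp

lemma eq_zero (hK : IsKernel K) {z : E n} (hz : 1 < ‖z‖) : K z = 0 := by
  by_contra h
  have := hK.supp (subset_tsupport K h)
  simp at this
  linarith

lemma continuous (hK : IsKernel K) : Continuous K := hK.smooth.continuous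

lemma differentiable (hK : IsKernel K) : Differentiable ℝ K :=
  hK.smooth.differentiable (by simp)

lemma pderiv (hK : IsKernel K) (i : Fin n) : IsKernel (pd i K) where
  smooth := contDiff_pd hK.smooth (by simp) i
  supp := (tsupport_fderiv_apply_subset ℝ _).trans hK.supp

lemma coord_mul (hK : IsKernel K) (i : Fin n) : IsKernel (fun z => z i * K z) where
  smooth := (contDiff_coord i).mul hK.smooth
  supp := (tsupport_mul_subset_right (f := fun z : E n => z i) (g := K)).trans hK.supp

lemma integrable_mul (hK : IsKernel K) {g : E n → ℝ} (hg : Continuous g) :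
    Integrable (fun z => K z * g z) :=
  (hK.continuous.mul hg).integrable_of_hasCompactSupport hK.hasCompactSupport.mul_right

lemma integrable (hK : IsKernel K) : Integrable K :=
  hK.continuous.integrable_of_hasCompactSupport hK.hasCompactSupport

lemma exists_integral_mul_le (hK : IsKernel K) :
    ∃ C, 0 ≤ C ∧ ∀ (g : E n → ℝ) (M : ℝ), Continuous g → (∀ z, ‖z‖ ≤ 1 → |g z| ≤ M) →
      |∫ z, K z * g z| ≤ C * M := by
  refine ⟨∫ z, |K z|, integral_nonneg fun z => abs_nonneg _, fun g M hg hM => ?_⟩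
  rw [← integral_mul_const]
  refine (abs_integral_le_integral_abs (f := fun z => K z * g z)).trans ?_
  refine integral_mono (hK.integrable_mul hg).abs (hK.integrable.abs.mul_const M) fun z => ?_
  change |K z * g z| ≤ |K z| * M
  rw [abs_mul]
  rcases le_or_gt ‖z‖ 1 with hz | hz
  · exact mul_le_mul_of_nonneg_left (hM z hz) (abs_nonneg _)
  · simp [hK.eq_zero hz]

lemma hasDerivAt_integral (hK : IsKernel K) {u : E n → ℝ} (hu : ContDiff ℝ 1 u)
    {c b : E n → E n} (hc : Continuous c) (hb : Continuous b) (s₀ : ℝ) :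
    HasDerivAt (fun s : ℝ => ∫ z, K z * u (c z + s • b z))
      (∫ z, K z * fderiv ℝ u (c z + s₀ • b z) (b z)) s₀ := by
  have hF : Continuous (fun p : ℝ × E n => K p.2 * fderiv ℝ u (c p.2 + p.1 • b p.2) (b p.2)) := by
    have h1 := hu.continuous_fderiv (by norm_num)
    have h2 := hK.continuous
    have h3 : Continuous fun p : ℝ × E n => fderiv ℝ u (c p.2 + p.1 • b p.2) :=
      h1.comp (by fun_prop)
    have h4 : Continuous fun p : ℝ × E n => fderiv ℝ u (c p.2 + p.1 • b p.2) (b p.2) :=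
      h3.clm_apply (by fun_prop)
    exact (h2.comp continuous_snd).mul h4
  obtain ⟨M, hM⟩ := ((isCompact_Icc (a := s₀ - 1) (b := s₀ + 1)).prod
    (isCompact_closedBall (0 : E n) 1)).exists_bound_of_continuousOn hF.continuousOn
  have key := hasDerivAt_integral_of_dominated_loc_of_deriv_le (μ := (volume : Measure (E n)))
    (F := fun s z => K z * u (c z + s • b z))
    (F' := fun s z => K z * fderiv ℝ u (c z + s • b z) (b z)) (x₀ := s₀)
    (s := Icc (s₀ - 1) (s₀ + 1)) (bound := (Metric.closedBall (0 : E n) 1).indicator fun _ => M)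
    (Icc_mem_nhds (by linarith) (by linarith)) ?_ ?_ ?_ ?_ ?_ ?_
  · exact key.2
  · refine Eventually.of_forall fun s => Continuous.aestronglyMeasurable ?_
    have := hu.continuous
    have := hK.continuous
    fun_prop
  · refine hK.integrable_mul ?_
    have := hu.continuous
    fun_prop
  · exact Continuous.aestronglyMeasurable
      (hF.comp (Continuous.prodMk continuous_const continuous_id))
  · refine Eventually.of_forall fun z s hs => ?_
    by_cases hz : z ∈ Metric.closedBall (0 : E n) 1
    · rw [indicator_of_mem hz]
      exact hM (s, z) ⟨hs, hz⟩
    · rw [indicator_of_notMem hz]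
      simp at hz
      simp [hK.eq_zero hz]
  · exact (integrable_indicator_iff measurableSet_closedBall).2
      (integrableOn_const (by exact measure_closedBall_lt_top.ne))
  · refine Eventually.of_forall fun z s _ => ?_
    have h1 : HasDerivAt (fun s : ℝ => c z + s • b z) (b z) s := by
      simpa using ((hasDerivAt_id s).smul_const (b z)).const_add (c z)
    have h2 := ((hu.differentiable (by norm_num) _).hasFDerivAt.comp_hasDerivAt s h1)
    exact h2.const_mul (K z)

end IsKernel

/-- The average of `u` around `x` at scale `t`, weighted by the kernel `K`. -/
noncomputable def avg (K : E n → ℝ) (t : ℝ) (u : E n → ℝ) (x : E n) : ℝ :=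
  ∫ z, K z * u (x + t • z)

variable {K L : E n → ℝ} {u : E n → ℝ}

lemma mul_avg_pd (hK : IsKernel K) (hu : ContDiff ℝ 1 u) (t : ℝ) (x : E n) (i : Fin n) :
    t * avg K t (pd i u) x = - avg (pd i K) t u x := by
  have hg : ContDiff ℝ 1 (fun z : E n => u (x + t • z)) := hu.comp (by fun_prop)
  have hpd : ∀ z, pd i (fun z : E n => u (x + t • z)) z = t * pd i u (x + t • z) := fun z => by
    simpa using pd_comp_affine u 1 0 t x z i
  have h := integral_mul_fderiv_eq_neg_fderiv_mul_of_integrable (μ := (volume : Measure (E n)))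
    (f := K) (g := fun z : E n => u (x + t • z)) (v := EuclideanSpace.single i 1)
    ((hK.pderiv i).integrable_mul hg.continuous) (hK.integrable_mul (continuous_pd hg i))
    (hK.integrable_mul hg.continuous) (fun z _ => hK.differentiable z)
    (fun z _ => hg.differentiable (by norm_num) z)
  change ∫ z, K z * pd i (fun z : E n => u (x + t • z)) z = - avg (pd i K) t u x at h
  rw [← h, avg, ← integral_const_mul]
  refine integral_congr_ae (Eventually.of_forall fun z => ?_)
  simp only [hpd]
  ring

lemma avg_sum {ι : Type*} (s : Finset ι) {K : ι → E n → ℝ} (hK : ∀ i ∈ s, IsKernel (K i))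
    (hu : Continuous u) (t : ℝ) (x : E n) :
    avg (fun z => ∑ i ∈ s, K i z) t u x = ∑ i ∈ s, avg (K i) t u x := by
  simp only [avg, Finset.sum_mul]
  refine integral_finsetSum _ fun i hi => (hK i hi).integrable_mul (by fun_prop)

lemma avg_sum_right {ι : Type*} (s : Finset ι) (hK : IsKernel K) {u : ι → E n → ℝ}
    (hu : ∀ i ∈ s, Continuous (u i)) (t : ℝ) (x : E n) :
    avg K t (fun z => ∑ i ∈ s, u i z) x = ∑ i ∈ s, avg K t (u i) x := by
  simp only [avg, Finset.mul_sum]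
  refine integral_finsetSum _ fun i hi => hK.integrable_mul ?_
  have := hu i hi
  fun_prop

lemma hasDerivAt_avg_line (hK : IsKernel K) (hu : ContDiff ℝ 1 u) (t : ℝ) (x e : E n) (s : ℝ) :
    HasDerivAt (fun s : ℝ => avg K t u (x + s • e))
      (∑ i, e i * avg K t (pd i u) (x + s • e)) s := by
  have h := hK.hasDerivAt_integral hu (c := fun z => x + t • z) (b := fun _ => e)
    (by fun_prop) (by fun_prop) s
  convert h using 1
  · ext s
    simp only [avg]
    congr 1; ext z; congr 2; abel
  · simp only [avg, fderiv_apply_eq_sum, Finset.mul_sum]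
    rw [integral_finsetSum]
    · refine Finset.sum_congr rfl fun i _ => ?_
      rw [← integral_const_mul]
      congr 1; ext z
      rw [show x + s • e + t • z = x + t • z + s • e by abel]
      ring
    · intro i _
      have := continuous_pd hu i
      exact hK.integrable_mul (by fun_prop)

lemma hasDerivAt_avg_scale (hK : IsKernel K) (hu : ContDiff ℝ 1 u) (x : E n) (t : ℝ) :
    HasDerivAt (fun t : ℝ => avg K t u x)
      (∑ i, avg (fun z => z i * K z) t (pd i u) x) t := by
  have h := hK.hasDerivAt_integral hu (c := fun _ => x) (b := fun z => z)
    (by fun_prop) (by fun_prop) t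
  refine h.congr_deriv ?_
  symm
  simp only [avg, fderiv_apply_eq_sum, Finset.mul_sum]
  rw [integral_finsetSum]
  · refine Finset.sum_congr rfl fun i _ => ?_
    congr 1; ext z
    ring
  · intro i _
    have := continuous_pd hu i
    exact hK.integrable_mul (by fun_prop)

/-- Pairs of kernels for which the scale derivative of `t⁻ᵐ * avg K t u` is
`t¹⁻ᵐ * avg L t (Δ u)`. -/
structure IsPair (m : ℕ) (K L : E n → ℝ) : Prop where
  left : IsKernel K
  right : IsKernel L
  eq : ∀ z, elaplacian L z + ∑ l, pd l (fun z => z l * K z) z + m * K z = 0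

lemma pd_elaplacian {L : E n → ℝ} (hL : ContDiff ℝ 3 L) (i : Fin n) (z : E n) :
    pd i (elaplacian L) z = elaplacian (pd i L) z := by
  have h1 : ∀ l, ContDiff ℝ 2 (pd l L) := fun l => contDiff_pd hL (by norm_num) l
  have h2 : ∀ l, ContDiff ℝ 1 (pd l (pd l L)) := fun l => contDiff_pd_one (h1 l) l
  have : pd i (elaplacian L) z = ∑ l, pd i (pd l (pd l L)) z :=
    pd_sum (u := fun l => pd l (pd l L)) (fun l _ => (h2 l).differentiable (by norm_num) z) i
  rw [this, elaplacian_eq_sum_pd]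
  refine Finset.sum_congr rfl fun l _ => ?_
  rw [pd_comm (h1 l)]
  congr 1
  ext y
  exact pd_comm (hL.of_le (by norm_num)) i l y

lemma IsPair.pderiv {m : ℕ} (h : IsPair m K L) (i : Fin n) :
    IsPair (m + 1) (pd i K) (pd i L) where
  left := h.left.pderiv i
  right := h.right.pderiv i
  eq z := by
    have hK := h.left
    have h0 : pd i
        (fun z => elaplacian L z + ∑ l, pd l (fun z => z l * K z) z + m * K z) z
          = 0 :=
      (congrArg (fun F => pd i F z) (funext h.eq)).trans (by simp [pd])
    have hd1 : Differentiable ℝ (elaplacian L) := by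
      have : ContDiff ℝ 1 (elaplacian L) := ContDiff.sum fun l _ =>
        ((h.right.pderiv l).pderiv l).smooth.of_le (by exact_mod_cast le_top)
      exact this.differentiable (by norm_num)
    have hd2 : ∀ l, Differentiable ℝ (pd l (fun z => z l * K z)) := fun l =>
      ((hK.coord_mul l).pderiv l).differentiable
    have hd3 : Differentiable ℝ fun z => ∑ l, pd l (fun z => z l * K z) z :=
      Differentiable.fun_sum fun l _ => hd2 l
    rw [pd_add ((hd1 z).fun_add (hd3 z)) ((hK.differentiable z).const_mul _),
      pd_add (hd1 z) (hd3 z),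
      pd_const_mul (hK.differentiable z), pd_sum (fun l _ => hd2 l z),
      pd_elaplacian (contDiff_infty.1 h.right.smooth 3)] at h0
    have h1 : ∀ l, pd i (pd l (fun z => z l * K z)) z
        = pd l (fun z => z l * pd i K z) z
          + if l = i then pd i K z else 0 := by
      intro l
      rw [pd_comm (contDiff_infty.1 (hK.coord_mul l).smooth 2)]
      have : pd i (fun z => z l * K z)
          = fun z => z l * pd i K z + (if l = i then 1 else 0) * K z := by
        ext y
        rw [pd_mul ((contDiff_coord (m := 1) l).differentiable (by norm_num) y)
          (hK.differentiable y), pd_coord]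
      rw [this, pd_add (((hK.pderiv i).coord_mul l).differentiable z)
        ((hK.differentiable z).const_mul _), pd_const_mul (hK.differentiable z)]
      split_ifs with hli
      · rw [hli]; ring
      · ring
    simp only [h1, Finset.sum_add_distrib, Finset.sum_ite_eq', Finset.mem_univ, if_true] at h0
    push_cast
    linarith

lemma avg_elaplacian (hL : IsKernel L) (hu : ContDiff ℝ 2 u) (t : ℝ) (x : E n) :
    t ^ 2 * avg L t (elaplacian u) x = avg (elaplacian L) t u x := by
  have h1 : avg L t (elaplacian u) x = ∑ i, avg L t (pd i (pd i u)) x :=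
    avg_sum_right (u := fun i => pd i (pd i u)) _ hL
      (fun i _ => continuous_pd (contDiff_pd_one hu i) i) t x
  have h2 : avg (elaplacian L) t u x = ∑ i, avg (pd i (pd i L)) t u x :=
    avg_sum (K := fun i => pd i (pd i L)) _ (fun i _ => (hL.pderiv i).pderiv i) hu.continuous t x
  rw [h1, h2, Finset.mul_sum]
  refine Finset.sum_congr rfl fun i _ => ?_
  have a := mul_avg_pd hL (contDiff_pd_one hu i) t x i
  have b := mul_avg_pd (hL.pderiv i) (hu.of_le (by norm_num)) t x i
  rw [pow_two, mul_assoc, a, mul_neg, b, neg_neg]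

lemma IsPair.hasDerivAt {m : ℕ} (h : IsPair m K L) (hu : ContDiff ℝ 2 u) (x : E n) {t : ℝ}
    (ht : 0 < t) : HasDerivAt (fun t : ℝ => (t ^ m)⁻¹ * avg K t u x)
      (t * (t ^ m)⁻¹ * avg L t (elaplacian u) x) t := by
  have hu1 : ContDiff ℝ 1 u := hu.of_le (by norm_num)
  have h1 := hasDerivAt_avg_scale h.left hu1 x t
  have h2 : HasDerivAt (fun t : ℝ => (t ^ m)⁻¹) (-(m * t ^ (m - 1)) / (t ^ m) ^ 2) t :=
    (hasDerivAt_pow m t).inv (by positivity)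
  refine (h2.mul h1).congr_deriv ?_
  have h3 : t * ∑ i, avg (fun z => z i * K z) t (pd i u) x
      = t ^ 2 * avg L t (elaplacian u) x + m * avg K t u x := by
    rw [Finset.mul_sum, avg_elaplacian h.right hu]
    have h4 : ∀ i, t * avg (fun z => z i * K z) t (pd i u) x
        = - avg (pd i (fun z => z i * K z)) t u x := fun i =>
      mul_avg_pd (h.left.coord_mul i) hu1 t x i
    simp only [h4, Finset.sum_neg_distrib]
    rw [← avg_sum Finset.univ (fun i _ => (h.left.coord_mul i).pderiv i) hu.continuous]
    have hc : Continuous fun z : E n => u (x + t • z) := by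
      have := hu.continuous
      fun_prop
    have hS : Integrable fun z => (∑ i, pd i (fun z => z i * K z) z)
        * u (x + t • z) := by
      simp only [Finset.sum_mul]
      exact integrable_finsetSum _ fun i _ => ((h.left.coord_mul i).pderiv i).integrable_mul hc
    have h5 : avg (elaplacian L) t u x + avg (fun z => ∑ i, pd i
        (fun z => z i * K z) z) t u x + m * avg K t u x = 0 := by
      simp only [avg]
      rw [← integral_const_mul, ← integral_add _ hS, ← integral_add _ _]
      · refine integral_eq_zero_of_ae (Eventually.of_forall fun z => ?_)
        have := h.eq z
        change _ = (0 : ℝ)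
        linear_combination this * u (x + t • z)
      · refine Integrable.add ?_ hS
        simp only [elaplacian_eq_sum_pd, Finset.sum_mul]
        exact integrable_finsetSum _ fun i _ => ((h.right.pderiv i).pderiv i).integrable_mul hc
      · exact (h.left.integrable_mul hc).const_mul _
      · simp only [elaplacian_eq_sum_pd, Finset.sum_mul]
        exact integrable_finsetSum _ fun i _ => ((h.right.pderiv i).pderiv i).integrable_mul hc
    linarith
  have h4 : ∑ i, avg (fun z => z i * K z) t (pd i u) x
      = t * avg L t (elaplacian u) x + m * avg K t u x / t := by
    field_simp
    linear_combination h3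
  rw [h4]
  rcases m with _ | m
  · simp
  · simp only [Nat.add_sub_cancel]
    field_simp
    push_cast
    ring

lemma pd_comp_real {g : ℝ → ℝ} {f : E n → ℝ} {x : E n} (hg : DifferentiableAt ℝ g (f x))
    (hf : DifferentiableAt ℝ f x) (i : Fin n) :
    pd i (fun y => g (f y)) x = deriv g (f x) * pd i f x := by
  have := hg.hasDerivAt.comp_hasFDerivAt x hf.hasFDerivAt
  have h2 := this.fderiv
  simp only [pd]
  change (fderiv ℝ (g ∘ f) x) _ = _
  rw [h2]
  simp

lemma pd_norm_sq (x : E n) (i : Fin n) : pd i (fun y : E n => ‖y‖ ^ 2) x = 2 * x i := by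
  have h : (fun y : E n => ‖y‖ ^ 2) = fun y => ∑ l, y l * y l := by
    ext y
    rw [EuclideanSpace.norm_sq_eq]
    simp [pow_two]
  have hd : ∀ l, DifferentiableAt ℝ (fun y : E n => y l) x := fun l =>
    (contDiff_coord (m := 1) l).differentiable (by norm_num) x
  rw [h, pd_sum (u := fun l (y : E n) => y l * y l) (fun l _ => (hd l).mul (hd l))]
  simp only [pd_mul (hd _) (hd _), pd_coord]
  simp [Finset.sum_add_distrib]
  ring

/-- A radial mollifier `φ` together with the potential `ψ` solving `∇ψ = - z φ`. -/
lemma exists_mollifier_pair (hn : 0 < n) : ∃ φ ψ : E n → ℝ, IsPair 0 φ ψ ∧ (∀ z, 0 ≤ φ z) ∧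
    (∀ z, 0 ≤ ψ z) ∧ ∫ z, φ z = 1 ∧ 0 < ∫ z, ψ z := by
  have hTs : ContDiff ℝ ∞ expNegInvGlue := expNegInvGlue.contDiff
  have hTm : Monotone expNegInvGlue := expNegInvGlue.monotone
  set T := expNegInvGlue with hT
  have hT0 : ∀ s, s ≤ 0 → T s = 0 := fun s hs => expNegInvGlue.zero_of_nonpos hs
  have hdT : ContDiff ℝ ∞ (deriv T) := (contDiff_infty_iff_deriv.1 hTs).2
  have hdT0 : ∀ s, s < 0 → deriv T s = 0 := fun s hs => by
    have : T =ᶠ[𝓝 s] fun _ => 0 := by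
      filter_upwards [Iio_mem_nhds hs] with r hr using hT0 r (le_of_lt hr)
    rw [this.deriv_eq]
    simp
  have hnorm : ContDiff ℝ ∞ fun z : E n => 1 - ‖z‖ ^ 2 := contDiff_const.sub (contDiff_norm_sq ℝ)
  have key : ∀ g : ℝ → ℝ, ContDiff ℝ ∞ g → (∀ s, s < 0 → g s = 0) →
      IsKernel fun z : E n => g (1 - ‖z‖ ^ 2) := by
    intro g hg hg0
    refine ⟨hg.comp hnorm, closure_minimal (fun z hz => ?_) Metric.isClosed_closedBall⟩
    by_contra h
    simp only [Metric.mem_closedBall, dist_zero_right, not_le] at h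
    exact hz (hg0 _ (by nlinarith))
  have hψ := key T hTs fun s hs => hT0 s hs.le
  have hφ := key (fun s => 2 * deriv T s) (contDiff_const.mul hdT) fun s hs => by simp [hdT0 s hs]
  set ψ := fun z : E n => T (1 - ‖z‖ ^ 2) with hψd
  set φ := fun z : E n => 2 * deriv T (1 - ‖z‖ ^ 2) with hφd
  have hpd : ∀ i, pd i ψ = fun z => -1 * (z i * φ z) := by
    intro i
    ext z
    rw [hψd, pd_comp_real (hTs.differentiable (by simp) _) (hnorm.differentiable (by simp) z)]
    have : pd i (fun y : E n => 1 - ‖y‖ ^ 2) z = - (2 * z i) := by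
      rw [← pd_norm_sq]
      simp [pd, fderiv_const_sub]
    rw [this, hφd]
    ring
  have hpair : IsPair 0 φ ψ := ⟨hφ, hψ, fun z => by
    rw [elaplacian_eq_sum_pd]
    simp only [hpd]
    simp only [pd_const_mul ((hφ.coord_mul _).differentiable z), ← Finset.mul_sum]
    simp⟩
  have hψ0 : ∀ z, 0 ≤ ψ z := fun z => expNegInvGlue.nonneg _
  have hφ0 : ∀ z, 0 ≤ φ z := fun z => mul_nonneg (by norm_num) hTm.deriv_nonneg
  have hψpos : 0 < ψ 0 := by
    simp only [hψd]
    exact expNegInvGlue.pos_of_pos (by simp)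
  have hIψ : 0 < ∫ z, ψ z :=
    hψ.continuous.integral_pos_of_hasCompactSupport_nonneg_nonzero hψ.hasCompactSupport hψ0
      hψpos.ne'
  have hex : ∃ z, φ z ≠ 0 := by
    by_contra! h
    have h1 : ∀ z, fderiv ℝ ψ z = 0 := fun z => by
      ext v
      rw [fderiv_apply_eq_sum]
      simp [hpd, h]
    have h2 := is_const_of_fderiv_eq_zero hψ.differentiable h1 0
      (EuclideanSpace.single ⟨0, hn⟩ 2)
    rw [hψ.eq_zero (z := EuclideanSpace.single ⟨0, hn⟩ 2) (by simp)] at h2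
    exact hψpos.ne' h2
  obtain ⟨z₀, hz₀⟩ := hex
  have hIφ : 0 < ∫ z, φ z :=
    hφ.continuous.integral_pos_of_hasCompactSupport_nonneg_nonzero hφ.hasCompactSupport hφ0 hz₀
  set c := ∫ z, φ z with hc
  have hsm : ∀ K : E n → ℝ, IsKernel K → IsKernel fun z => c⁻¹ * K z := fun K hK =>
    ⟨contDiff_const.mul hK.smooth,
      (tsupport_mul_subset_right (f := fun _ : E n => c⁻¹) (g := K)).trans hK.supp⟩
  refine ⟨fun z => c⁻¹ * φ z, fun z => c⁻¹ * ψ z, ⟨hsm _ hφ, hsm _ hψ, fun z => ?_⟩,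
    fun z => mul_nonneg (inv_nonneg.2 hIφ.le) (hφ0 z),
    fun z => mul_nonneg (inv_nonneg.2 hIφ.le) (hψ0 z), ?_, ?_⟩
  · have h1 : ∀ l, pd l (fun z => c⁻¹ * ψ z) = fun z => c⁻¹ * pd l ψ z := fun l => by
      ext y
      exact pd_const_mul (hψ.differentiable y) _ _
    have h2 : ∀ l, pd l (fun z : E n => z l * (c⁻¹ * φ z)) z
        = c⁻¹ * pd l (fun z => z l * φ z) z := fun l => by
      rw [← pd_const_mul ((hφ.coord_mul l).differentiable z)]
      congr 1
      ext y
      ring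
    have h3 := hpair.eq z
    rw [elaplacian_eq_sum_pd] at h3 ⊢
    simp only [h1, h2, pd_const_mul ((hψ.pderiv _).differentiable z), ← Finset.mul_sum]
    simp only [Nat.cast_zero, zero_mul, add_zero] at h3 ⊢
    rw [← mul_add, h3, mul_zero]
  · rw [integral_const_mul]
    exact inv_mul_cancel₀ hIφ.ne'
  · rw [integral_const_mul]
    exact mul_pos (inv_pos.2 hIφ) hIψ

lemma abs_sub_le_of_deriv_le_rpow {f f' : ℝ → ℝ} {M γ s t : ℝ} (hγ : γ ≠ 0) (hs : 0 < s)
    (hst : s ≤ t) (hf : ∀ r ∈ Icc s t, HasDerivAt f (f' r) r)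
    (hb : ∀ r ∈ Icc s t, |f' r| ≤ M * r ^ (γ - 1)) :
    |f t - f s| ≤ M / γ * (t ^ γ - s ^ γ) := by
  have hB : ∀ r ∈ Icc s t, HasDerivAt (fun r : ℝ => M / γ * (r ^ γ - s ^ γ))
      (M * r ^ (γ - 1)) r := fun r hr => by
    have h := ((Real.hasDerivAt_rpow_const (p := γ)
      (Or.inl (hs.trans_le hr.1).ne')).sub_const (s ^ γ)).const_mul (M / γ)
    refine h.congr_deriv ?_
    field_simp
  have := image_norm_le_of_norm_deriv_right_le_deriv_boundary' (f := fun r => f r - f s)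
    (f' := f') (a := s) (b := t) (B := fun r : ℝ => M / γ * (r ^ γ - s ^ γ))
    (B' := fun r => M * r ^ (γ - 1))
    (fun r hr => ((hf r hr).sub_const _).continuousAt.continuousWithinAt)
    (fun r hr => ((hf r (Ico_subset_Icc_self hr)).sub_const _).hasDerivWithinAt) (by simp)
    (fun r hr => (hB r hr).continuousAt.continuousWithinAt)
    (fun r hr => (hB r (Ico_subset_Icc_self hr)).hasDerivWithinAt)
    (fun r hr => hb r (Ico_subset_Icc_self hr)) (right_mem_Icc.2 hst)
  simpa using this

lemma exists_forall_integral_mul_le {ι : Type*} [Fintype ι] {K : ι → E n → ℝ}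
    (hK : ∀ l, IsKernel (K l)) :
    ∃ C, 0 ≤ C ∧ ∀ l (g : E n → ℝ) (M : ℝ), Continuous g → (∀ z, ‖z‖ ≤ 1 → |g z| ≤ M) →
      |∫ z, K l z * g z| ≤ C * M := by
  choose C hC0 hC using fun l => (hK l).exists_integral_mul_le
  refine ⟨∑ l, C l, Finset.sum_nonneg fun l _ => hC0 l, fun l g M hg hM => ?_⟩
  refine (hC l g M hg hM).trans (mul_le_mul_of_nonneg_right ?_ ?_)
  · exact Finset.single_le_sum (fun l _ => hC0 l) (Finset.mem_univ l)
  · exact (abs_nonneg _).trans (hM 0 (by simp))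

lemma tendsto_avg_zero (hK : IsKernel K) {g : E n → ℝ} (hg : Continuous g) (x : E n) :
    Tendsto (fun t => avg K t g x) (𝓝 0) (𝓝 (g x * ∫ z, K z)) := by
  obtain ⟨C, hC0, hC⟩ := hK.exists_integral_mul_le
  rw [Metric.tendsto_nhds_nhds]
  intro ε hε
  obtain ⟨δ, hδ, h⟩ := Metric.continuous_iff.1 hg x (ε / (C + 1)) (by positivity)
  refine ⟨δ, hδ, fun t ht => ?_⟩
  rw [dist_zero_right, Real.norm_eq_abs] at ht
  have hc : Continuous fun z : E n => g (x + t • z) := by fun_prop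
  have h1 : avg K t g x - g x * ∫ z, K z = ∫ z, K z * (g (x + t • z) - g x) := by
    rw [avg, ← integral_const_mul, ← integral_sub (hK.integrable_mul hc)
      (hK.integrable.const_mul _)]
    congr 1; ext z; ring
  rw [Real.dist_eq, h1]
  have h2 := hC (fun z => g (x + t • z) - g x) (ε / (C + 1)) (by fun_prop) fun z hz => by
    rw [← Real.dist_eq]
    refine (h (x + t • z) ?_).le
    rw [dist_eq_norm, add_sub_cancel_left, norm_smul, Real.norm_eq_abs]
    exact (mul_le_of_le_one_right (abs_nonneg t) hz).trans_lt ht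
  refine h2.trans_lt ?_
  rw [mul_div_assoc', div_lt_iff₀ (by positivity)]
  nlinarith

lemma integral_pd_eq_zero (hK : IsKernel K) (i : Fin n) : ∫ z, pd i K z = 0 := by
  have := mul_avg_pd hK (u := fun _ => (1 : ℝ)) contDiff_const 0 0 i
  simpa [avg] using this

/-- Hölder continuity of a limit of averages, from bounds on the averages of the Laplacian. -/
lemma abs_sub_le_of_avg_bounds {m : ℕ} (h : IsPair m K L) (hu : ContDiff ℝ 2 u) {w : E n → ℝ}
    {R β M : ℝ} (hβ0 : 0 < β) (hβ1 : β < 1)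
    (hw : ∀ x, Tendsto (fun t => (t ^ m)⁻¹ * avg K t u x) (𝓝[>] 0) (𝓝 (w x)))
    (h1 : ∀ t x, 0 < t → t ≤ 1 → x ∈ Metric.ball (0 : E n) R →
      |t * (t ^ m)⁻¹ * avg L t (elaplacian u) x| ≤ M * t ^ (β - 1))
    (h2 : ∀ i t x, 0 < t → t ≤ 1 → x ∈ Metric.ball (0 : E n) R →
      |t * (t ^ (m + 1))⁻¹ * avg (pd i L) t (elaplacian u) x| ≤ M * t ^ (β - 1 - 1))
    (h3 : ∀ i x, x ∈ Metric.ball (0 : E n) R → |avg (pd i K) 1 u x| ≤ M)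
    {x y : E n} (hx : x ∈ Metric.ball (0 : E n) R) (hy : y ∈ Metric.ball (0 : E n) R)
    (hxy : ‖x - y‖ ≤ 1) :
    |w x - w y| ≤ (2 / β + n * (1 + 1 / (1 - β))) * M * ‖x - y‖ ^ β := by
  have hM : 0 ≤ M := by
    have := h1 1 x one_pos le_rfl hx
    simp only [Real.one_rpow, mul_one] at this
    exact (abs_nonneg _).trans this
  rcases eq_or_ne x y with rfl | hne
  · simp [hβ0.ne']
  set r := ‖x - y‖ with hr
  have hr0 : 0 < r := norm_pos_iff.2 (sub_ne_zero.2 hne)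
  have hlim : ∀ x ∈ Metric.ball (0 : E n) R, |(r ^ m)⁻¹ * avg K r u x - w x| ≤ M / β * r ^ β := by
    intro x hx
    refine le_of_tendsto ((tendsto_const_nhds.sub (hw x)).abs) ?_
    filter_upwards [Ioc_mem_nhdsGT hr0] with s hs
    have := abs_sub_le_of_deriv_le_rpow (M := M) hβ0.ne' hs.1 hs.2
      (fun t ht => h.hasDerivAt hu x (hs.1.trans_le ht.1))
      (fun t ht => h1 t x (hs.1.trans_le ht.1) (ht.2.trans hxy) hx)
    refine this.trans (mul_le_mul_of_nonneg_left ?_ (by positivity))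
    have := Real.rpow_nonneg hs.1.le β
    linarith
  have hder : ∀ i, ∀ x ∈ Metric.ball (0 : E n) R,
      |(r ^ (m + 1))⁻¹ * avg (pd i K) r u x| ≤ M * (1 + 1 / (1 - β)) * r ^ (β - 1) := by
    intro i x hx
    have := abs_sub_le_of_deriv_le_rpow (M := M) (γ := β - 1) (by linarith) hr0 hxy
      (fun t ht => (h.pderiv i).hasDerivAt hu x (hr0.trans_le ht.1))
      (fun t ht => h2 i t x (hr0.trans_le ht.1) ht.2 hx)
    simp only [one_pow, inv_one, one_mul, Real.one_rpow] at this
    have h4 := h3 i x hx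
    have h5 : 1 ≤ r ^ (β - 1) := Real.one_le_rpow_of_pos_of_le_one_of_nonpos hr0 hxy (by linarith)
    have h6 : M / (β - 1) * (1 - r ^ (β - 1)) = M * (1 / (1 - β)) * (r ^ (β - 1) - 1) := by
      have : β - 1 ≠ 0 := by linarith
      have : 1 - β ≠ 0 := by linarith
      field_simp
      ring
    have h7 : 0 ≤ M * (1 / (1 - β)) := mul_nonneg hM (one_div_nonneg.2 (by linarith))
    rw [h6] at this
    have h8 := abs_sub_abs_le_abs_sub ((r ^ (m + 1))⁻¹ * avg (pd i K) r u x) (avg (pd i K) 1 u x)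
    rw [abs_sub_comm] at h8
    nlinarith
  have hdiff : |(r ^ m)⁻¹ * avg K r u x - (r ^ m)⁻¹ * avg K r u y|
      ≤ n * (1 + 1 / (1 - β)) * M * r ^ β := by
    set e := x - y with he
    have hd : ∀ s : ℝ, HasDerivAt (fun s : ℝ => (r ^ m)⁻¹ * avg K r u (y + s • e))
        ((r ^ m)⁻¹ * ∑ i, e i * avg K r (pd i u) (y + s • e)) s := fun s =>
      (hasDerivAt_avg_line h.left (hu.of_le (by norm_num)) r y e s).const_mul _
    have hb : ∀ s ∈ Ico (0 : ℝ) 1, ‖(r ^ m)⁻¹ * ∑ i, e i * avg K r (pd i u) (y + s • e)‖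
        ≤ n * (1 + 1 / (1 - β)) * M * r ^ β := by
      intro s hs
      have hmem : y + s • e ∈ Metric.ball (0 : E n) R := by
        have := (convex_ball (0 : E n) R).add_smul_sub_mem hy hx ⟨hs.1, hs.2.le⟩
        exact this
      rw [Finset.mul_sum, Real.norm_eq_abs]
      refine (Finset.abs_sum_le_sum_abs _ _).trans ?_
      have hterm : ∀ i ∈ (Finset.univ : Finset (Fin n)),
          |(r ^ m)⁻¹ * (e i * avg K r (pd i u) (y + s • e))|
            ≤ M * (1 + 1 / (1 - β)) * r ^ β := by
        intro i _
        have e1 : (r ^ m)⁻¹ * (e i * avg K r (pd i u) (y + s • e))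
            = - (e i * ((r ^ (m + 1))⁻¹ * avg (pd i K) r u (y + s • e))) := by
          have := mul_avg_pd h.left (hu.of_le (by norm_num)) r (y + s • e) i
          rw [← neg_eq_iff_eq_neg] at this
          rw [← this]
          field_simp
          ring
        rw [e1, abs_neg, abs_mul]
        have e2 : |e i| ≤ r := PiLp.norm_apply_le e i
        have e3 : r ^ β = r * r ^ (β - 1) := by
          rw [Real.rpow_sub_one hr0.ne']
          field_simp
        rw [e3]
        calc |e i| * |(r ^ (m + 1))⁻¹ * avg (pd i K) r u (y + s • e)|
            ≤ r * (M * (1 + 1 / (1 - β)) * r ^ (β - 1)) :=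
              mul_le_mul e2 (hder i _ hmem) (abs_nonneg _) hr0.le
          _ = _ := by ring
      refine (Finset.sum_le_sum hterm).trans (le_of_eq ?_)
      simp
      ring
    have := norm_image_sub_le_of_norm_deriv_le_segment_01'
      (fun s _ => (hd s).hasDerivWithinAt) hb
    simpa [he] using this
  have a1 := hlim x hx
  have a2 := hlim y hy
  rw [abs_le] at *
  have : (2 / β + n * (1 + 1 / (1 - β))) * M * r ^ β
      = 2 * (M / β * r ^ β) + n * (1 + 1 / (1 - β)) * M * r ^ β := by ring
  rw [this]
  constructor <;> linarith [a1.1, a1.2, a2.1, a2.2, hdiff.1, hdiff.2]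

lemma norm_add_smul_lt {x z : E n} {R t : ℝ} (hx : x ∈ Metric.ball (0 : E n) R) (ht0 : 0 < t)
    (ht : t ≤ 1) (hz : ‖z‖ ≤ 1) : x + t • z ∈ Metric.ball (0 : E n) (R + 1) := by
  rw [mem_ball_zero_iff] at *
  have h1 := norm_add_le x (t • z)
  have h2 : ‖t • z‖ ≤ 1 := by
    rw [norm_smul, Real.norm_eq_abs, abs_of_pos ht0]
    exact mul_le_one₀ ht (norm_nonneg _) hz
  linarith

/-- Interior Hölder estimate for the gradient. -/
lemma exists_gradient_holder (hn : 0 < n) : ∃ C, 0 ≤ C ∧ ∀ (u : E n → ℝ) (R P Q : ℝ),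
    ContDiff ℝ 2 u → (∀ x ∈ Metric.ball (0 : E n) (R + 1), |u x| ≤ P) →
    (∀ x ∈ Metric.ball (0 : E n) (R + 1), |elaplacian u x| ≤ Q) →
    ∀ i, ∀ x ∈ Metric.ball (0 : E n) R, ∀ y ∈ Metric.ball (0 : E n) R, ‖x - y‖ ≤ 1 →
      |pd i u x - pd i u y| ≤ C * (P + Q) * ‖x - y‖ ^ (1 / 2 : ℝ) := by
  obtain ⟨φ, ψ, hp, -, -, hφ1, -⟩ := exists_mollifier_pair hn
  obtain ⟨C₁, hC₁, hC₁'⟩ := exists_forall_integral_mul_le fun i => hp.right.pderiv i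
  obtain ⟨C₂, hC₂, hC₂'⟩ := exists_forall_integral_mul_le
    (K := fun ij : Fin n × Fin n => pd ij.2 (pd ij.1 ψ))
    fun ij => (hp.right.pderiv ij.1).pderiv ij.2
  obtain ⟨C₃, hC₃, hC₃'⟩ := exists_forall_integral_mul_le
    (K := fun ij : Fin n × Fin n => pd ij.2 (pd ij.1 φ))
    fun ij => (hp.left.pderiv ij.1).pderiv ij.2
  refine ⟨(2 / (1 / 2) + n * (1 + 1 / (1 - 1 / 2))) * (C₁ + C₂ + C₃), by positivity, ?_⟩
  intro u R P Q hu hP hQ i x hx y hy hxy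
  have hx1 : x ∈ Metric.ball (0 : E n) (R + 1) := Metric.ball_subset_ball (by linarith) hx
  have hP0 : 0 ≤ P := (abs_nonneg _).trans (hP x hx1)
  have hQ0 : 0 ≤ Q := (abs_nonneg _).trans (hQ x hx1)
  have hf := continuous_elaplacian hu
  have hu0 := hu.continuous
  have key := abs_sub_le_of_avg_bounds (hp.pderiv i) hu (w := fun x => - pd i u x) (R := R)
    (β := 1 / 2) (M := (C₁ + C₂ + C₃) * (P + Q)) (by norm_num) (by norm_num) ?_ ?_ ?_ ?_ hx hy hxy
  · rw [abs_sub_comm]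
    simp only [neg_sub_neg] at key
    refine key.trans (le_of_eq ?_)
    ring
  · intro x
    have h0 := (tendsto_avg_zero hp.left (continuous_pd (hu.of_le (by norm_num)) i) x).neg
    rw [hφ1, mul_one] at h0
    refine (h0.mono_left nhdsWithin_le_nhds).congr' ?_
    filter_upwards [self_mem_nhdsWithin] with t ht
    have ht : t ≠ 0 := (mem_Ioi.1 ht).ne'
    have := mul_avg_pd hp.left (hu.of_le (by norm_num)) t x i
    rw [← neg_eq_iff_eq_neg] at this
    rw [← this]
    field_simp
    simp
  · intro t x ht0 ht1 hx
    have e : t * (t ^ (0 + 1))⁻¹ * avg (pd i ψ) t (elaplacian u) x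
        = avg (pd i ψ) t (elaplacian u) x := by
      field_simp
      ring
    rw [e]
    have := hC₁' i (fun z => elaplacian u (x + t • z)) Q (by fun_prop)
      fun z hz => hQ _ (norm_add_smul_lt hx ht0 ht1 hz)
    refine this.trans ?_
    have h1 : 1 ≤ t ^ ((1 / 2 : ℝ) - 1) :=
      Real.one_le_rpow_of_pos_of_le_one_of_nonpos ht0 ht1 (by norm_num)
    calc C₁ * Q ≤ (C₁ + C₂ + C₃) * (P + Q) := by gcongr <;> linarith
      _ ≤ _ := le_mul_of_one_le_right (by positivity) h1
  · intro l t x ht0 ht1 hx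
    have e : t * (t ^ (0 + 1 + 1))⁻¹ * avg (pd l (pd i ψ)) t (elaplacian u) x
        = avg (pd l (pd i ψ)) t (elaplacian u) x * t⁻¹ := by field_simp
    rw [e, abs_mul, abs_of_pos (inv_pos.2 ht0)]
    have := hC₂' (i, l) (fun z => elaplacian u (x + t • z)) Q (by fun_prop)
      fun z hz => hQ _ (norm_add_smul_lt hx ht0 ht1 hz)
    have h1 : t⁻¹ ≤ t ^ ((1 / 2 : ℝ) - 1 - 1) := by
      rw [← Real.rpow_neg_one]
      exact Real.rpow_le_rpow_of_exponent_ge ht0 ht1 (by norm_num)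
    refine mul_le_mul (this.trans ?_) h1 (inv_nonneg.2 ht0.le) (by positivity)
    gcongr <;> linarith
  · intro l x hx
    have := hC₃' (i, l) (fun z => u (x + (1 : ℝ) • z)) P (by fun_prop)
      fun z hz => hP _ (norm_add_smul_lt hx one_pos le_rfl hz)
    refine this.trans ?_
    gcongr <;> linarith

/-- Interior Hölder estimate for the second derivatives. -/
lemma exists_hessian_holder (hn : 0 < n) {α : ℝ} (hα0 : 0 < α) (hα1 : α < 1) :
    ∃ C, 0 ≤ C ∧ ∀ (u : E n → ℝ) (R P Q : ℝ),
    ContDiff ℝ 2 u → (∀ x ∈ Metric.ball (0 : E n) (R + 1), |u x| ≤ P) →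
    (∀ x ∈ Metric.ball (0 : E n) (R + 1), ∀ y ∈ Metric.ball (0 : E n) (R + 1), ‖x - y‖ ≤ 1 →
      |elaplacian u x - elaplacian u y| ≤ Q * ‖x - y‖ ^ α) → 0 ≤ Q →
    ∀ i j, ∀ x ∈ Metric.ball (0 : E n) R, ∀ y ∈ Metric.ball (0 : E n) R, ‖x - y‖ ≤ 1 →
      |pd i (pd j u) x - pd i (pd j u) y| ≤ C * (P + Q) * ‖x - y‖ ^ α := by
  obtain ⟨φ, ψ, hp, -, -, hφ1, -⟩ := exists_mollifier_pair hn
  obtain ⟨C₁, hC₁, hC₁'⟩ := exists_forall_integral_mul_le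
    (K := fun ij : Fin n × Fin n => pd ij.2 (pd ij.1 ψ))
    fun ij => (hp.right.pderiv ij.1).pderiv ij.2
  obtain ⟨C₂, hC₂, hC₂'⟩ := exists_forall_integral_mul_le
    (K := fun ij : (Fin n × Fin n) × Fin n => pd ij.2 (pd ij.1.2 (pd ij.1.1 ψ)))
    fun ij => ((hp.right.pderiv ij.1.1).pderiv ij.1.2).pderiv ij.2
  obtain ⟨C₃, hC₃, hC₃'⟩ := exists_forall_integral_mul_le
    (K := fun ij : (Fin n × Fin n) × Fin n => pd ij.2 (pd ij.1.2 (pd ij.1.1 φ)))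
    fun ij => ((hp.left.pderiv ij.1.1).pderiv ij.1.2).pderiv ij.2
  have hα2 : 0 < 1 - α := by linarith
  refine ⟨(2 / α + n * (1 + 1 / (1 - α))) * (C₁ + C₂ + C₃), by positivity, ?_⟩
  intro u R P Q hu hP hQ hQ0 i j x hx y hy hxy
  have hx1 : x ∈ Metric.ball (0 : E n) (R + 1) := Metric.ball_subset_ball (by linarith) hx
  have hP0 : 0 ≤ P := (abs_nonneg _).trans (hP x hx1)
  have hf := continuous_elaplacian hu
  have hu0 := hu.continuous
  have hosc : ∀ {C : ℝ} {K : E n → ℝ}, IsKernel K → ∀ l, 0 ≤ C →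
      (∀ (g : E n → ℝ) (M : ℝ), Continuous g → (∀ z, ‖z‖ ≤ 1 → |g z| ≤ M) →
        |∫ z, pd l K z * g z| ≤ C * M) → ∀ t x, 0 < t → t ≤ 1 → x ∈ Metric.ball (0 : E n) R →
      |avg (pd l K) t (elaplacian u) x| ≤ C * (Q * t ^ α) := by
    intro C K hK l hC0 hC t x ht0 ht1 hx
    have hc : Continuous fun z : E n => elaplacian u (x + t • z) := by fun_prop
    have e : avg (pd l K) t (elaplacian u) x
        = ∫ z, pd l K z * (elaplacian u (x + t • z) - elaplacian u x) := by
      simp only [mul_sub]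
      rw [integral_sub ((hK.pderiv l).integrable_mul hc) ((hK.pderiv l).integrable.mul_const _),
        integral_mul_const, integral_pd_eq_zero hK, zero_mul, sub_zero, avg]
    rw [e]
    refine hC _ _ (by fun_prop) fun z hz => ?_
    have hd : ‖x + t • z - x‖ ≤ t := by
      rw [add_sub_cancel_left, norm_smul, Real.norm_eq_abs, abs_of_pos ht0]
      exact mul_le_of_le_one_right ht0.le hz
    refine (hQ _ (norm_add_smul_lt hx ht0 ht1 hz) _
      (Metric.ball_subset_ball (by linarith) hx) (hd.trans ht1)).trans ?_
    gcongr
  have key := abs_sub_le_of_avg_bounds ((hp.pderiv i).pderiv j) hu (w := fun x => pd i (pd j u) x)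
    (R := R) (β := α) (M := (C₁ + C₂ + C₃) * (P + Q)) hα0 hα1 ?_ ?_ ?_ ?_ hx hy hxy
  · refine key.trans (le_of_eq ?_)
    ring
  · intro x
    have h0 := tendsto_avg_zero hp.left (continuous_pd (contDiff_pd_one hu j) i) x
    rw [hφ1, mul_one] at h0
    refine (h0.mono_left nhdsWithin_le_nhds).congr' ?_
    filter_upwards [self_mem_nhdsWithin] with t ht
    have ht : t ≠ 0 := (mem_Ioi.1 ht).ne'
    have h1 := mul_avg_pd hp.left (contDiff_pd_one hu j) t x i
    have h2 := mul_avg_pd (hp.left.pderiv i) (hu.of_le (by norm_num)) t x j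
    field_simp
    linear_combination t * h1 - h2
  · intro t x ht0 ht1 hx
    have e : t * (t ^ (0 + 1 + 1))⁻¹ * avg (pd j (pd i ψ)) t (elaplacian u) x
        = avg (pd j (pd i ψ)) t (elaplacian u) x * t⁻¹ := by field_simp
    rw [e, abs_mul, abs_of_pos (inv_pos.2 ht0), Real.rpow_sub_one ht0.ne', div_eq_mul_inv,
      ← mul_assoc]
    refine mul_le_mul_of_nonneg_right ?_ (inv_nonneg.2 ht0.le)
    refine (hosc (hp.right.pderiv i) j hC₁ (hC₁' (i, j)) t x ht0 ht1 hx).trans ?_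
    rw [← mul_assoc]
    gcongr <;> linarith
  · intro l t x ht0 ht1 hx
    have e : t * (t ^ (0 + 1 + 1 + 1))⁻¹ * avg (pd l (pd j (pd i ψ))) t (elaplacian u) x
        = avg (pd l (pd j (pd i ψ))) t (elaplacian u) x * (t⁻¹ * t⁻¹) := by field_simp
    rw [e, abs_mul, abs_of_pos (by positivity : (0 : ℝ) < t⁻¹ * t⁻¹), Real.rpow_sub_one ht0.ne',
      Real.rpow_sub_one ht0.ne', div_eq_mul_inv, div_eq_mul_inv, mul_assoc (t ^ α),
      ← mul_assoc ((C₁ + C₂ + C₃) * (P + Q))]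
    refine mul_le_mul_of_nonneg_right ?_ (by positivity)
    refine (hosc ((hp.right.pderiv i).pderiv j) l hC₂ (hC₂' ((i, j), l)) t x ht0 ht1 hx).trans ?_
    rw [← mul_assoc]
    gcongr <;> linarith
  · intro l x hx
    have := hC₃' ((i, j), l) (fun z => u (x + (1 : ℝ) • z)) P (by fun_prop)
      fun z hz => hP _ (norm_add_smul_lt hx one_pos le_rfl hz)
    refine this.trans ?_
    gcongr <;> linarith

lemma norm_le_sum_abs (v : E n) : ‖v‖ ≤ ∑ i, |v i| := by
  conv_lhs => rw [eq_sum_single v]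
  refine (norm_sum_le _ _).trans (le_of_eq ?_)
  simp [norm_smul]

lemma exists_contDiff_eventuallyEq {R : ℝ} (hR : 0 < R + 1)
    (hu : ContDiffOn ℝ 2 u (Metric.ball (0 : E n) (R + 2))) :
    ∃ w : E n → ℝ, ContDiff ℝ 2 w ∧ ∀ x ∈ Metric.ball (0 : E n) (R + 1), w =ᶠ[𝓝 x] u := by
  let f : ContDiffBump (0 : E n) := ⟨R + 1, R + 3 / 2, hR, by linarith⟩
  refine ⟨fun x => f x * u x, contDiff_iff_contDiffAt.2 fun x => ?_, fun x hx => ?_⟩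
  · by_cases hx : x ∈ Metric.ball (0 : E n) (R + 2)
    · exact (f.contDiff (n := 2)).contDiffAt.mul (hu.contDiffAt (Metric.isOpen_ball.mem_nhds hx))
    · have h : x ∉ tsupport f := by
        rw [f.tsupport_eq, Metric.mem_closedBall]
        rw [Metric.mem_ball] at hx
        change ¬ dist x 0 ≤ R + 3 / 2
        linarith
      rw [notMem_tsupport_iff_eventuallyEq] at h
      refine (contDiffAt_const (c := (0 : ℝ))).congr_of_eventuallyEq ?_
      filter_upwards [h] with y hy
      simp [hy]
  · filter_upwards [Metric.isOpen_ball.mem_nhds hx] with y hy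
    rw [f.one_of_mem_closedBall (Metric.ball_subset_closedBall hy), one_mul]

lemma abs_rpow_sub_rpow_le {q a b : ℝ} (hq0 : 0 ≤ q) (hq1 : q ≤ 1) (ha : 0 ≤ a) (hb : 0 ≤ b) :
    |a ^ q - b ^ q| ≤ |a - b| ^ q := by
  wlog hab : b ≤ a generalizing a b
  · rw [abs_sub_comm, abs_sub_comm a b]
    exact this hb ha (le_of_not_ge hab)
  rw [abs_of_nonneg (sub_nonneg.2 (Real.rpow_le_rpow hb hab hq0)),
    abs_of_nonneg (sub_nonneg.2 hab)]
  have := Real.rpow_add_le_add_rpow hb (sub_nonneg.2 hab) hq0 hq1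
  rw [add_sub_cancel] at this
  linarith

lemma exists_rpow_holder {q : ℝ} (hq : 0 ≤ q) : ∃ γ : ℝ, 0 < γ ∧ γ ≤ 1 ∧ ∀ S : ℝ, ∃ L, 0 ≤ L ∧
    ∀ a b : ℝ, 0 ≤ a → a ≤ S → 0 ≤ b → b ≤ S → |a ^ q - b ^ q| ≤ L * |a - b| ^ γ := by
  rcases hq.eq_or_lt with rfl | hq0
  · refine ⟨1, one_pos, le_rfl, fun S => ⟨0, le_rfl, fun a b _ _ _ _ => by simp⟩⟩
  rcases le_total q 1 with hq1 | hq1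
  · refine ⟨q, hq0, hq1, fun S => ⟨1, zero_le_one, fun a b ha _ hb _ => ?_⟩⟩
    rw [one_mul]
    exact abs_rpow_sub_rpow_le hq hq1 ha hb
  · refine ⟨1, one_pos, le_rfl, fun S => ⟨q * |S| ^ (q - 1), by positivity,
      fun a b ha haS hb hbS => ?_⟩⟩
    rw [Real.rpow_one]
    have := Convex.norm_image_sub_le_of_norm_hasDerivWithin_le (f := fun x : ℝ => x ^ q)
      (f' := fun x => q * x ^ (q - 1)) (s := Icc 0 S) (x := b) (y := a) (C := q * |S| ^ (q - 1))
      (fun x _ => (Real.hasDerivAt_rpow_const (Or.inr hq1)).hasDerivWithinAt)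
      (fun x hx => ?_) (convex_Icc _ _) ⟨hb, hbS⟩ ⟨ha, haS⟩
    · simpa using this
    · rw [Real.norm_eq_abs, abs_mul, abs_of_nonneg hq, abs_of_nonneg (Real.rpow_nonneg hx.1 _)]
      exact mul_le_mul_of_nonneg_left
        (Real.rpow_le_rpow hx.1 (hx.2.trans (le_abs_self S)) (by linarith)) hq

/-- A bounded function on the ball of radius `R` which is locally Hölder continuous. -/
structure HolderBound (α M R : ℝ) (f : E n → ℝ) : Prop where
  nonneg : 0 ≤ M
  bound : ∀ x ∈ Metric.ball (0 : E n) R, |f x| ≤ M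
  holder : ∀ x ∈ Metric.ball (0 : E n) R, ∀ y ∈ Metric.ball (0 : E n) R, ‖x - y‖ ≤ 1 →
    |f x - f y| ≤ M * ‖x - y‖ ^ α

namespace HolderBound

variable {α β M N R R' : ℝ} {f g : E n → ℝ}

lemma mono (h : HolderBound β M R f) (hαβ : α ≤ β) (hα : 0 < α) (hMN : M ≤ N) (hR : R' ≤ R) :
    HolderBound α N R' f where
  nonneg := h.nonneg.trans hMN
  bound x hx := (h.bound x (Metric.ball_subset_ball hR hx)).trans hMN
  holder x hx y hy hxy := by
    refine (h.holder x (Metric.ball_subset_ball hR hx) y (Metric.ball_subset_ball hR hy)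
      hxy).trans ?_
    refine mul_le_mul hMN ?_ (by positivity) (h.nonneg.trans hMN)
    exact Real.rpow_le_rpow_of_exponent_ge_of_imp (norm_nonneg _) hxy hαβ
      fun _ h0 => absurd h0 (hα.trans_le hαβ).ne'

lemma congr (h : HolderBound α M R f) (hfg : ∀ x ∈ Metric.ball (0 : E n) R, f x = g x) :
    HolderBound α M R g where
  nonneg := h.nonneg
  bound x hx := by rw [← hfg x hx]; exact h.bound x hx
  holder x hx y hy hxy := by rw [← hfg x hx, ← hfg y hy]; exact h.holder x hx y hy hxy

lemma const_mul (h : HolderBound α M R f) {c A : ℝ} (hc : |c| ≤ A) :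
    HolderBound α (A * M) R fun x => c * f x where
  nonneg := mul_nonneg ((abs_nonneg c).trans hc) h.nonneg
  bound x hx := by
    rw [abs_mul]
    exact mul_le_mul hc (h.bound x hx) (abs_nonneg _) ((abs_nonneg c).trans hc)
  holder x hx y hy hxy := by
    rw [← mul_sub, abs_mul, mul_assoc]
    exact mul_le_mul hc (h.holder x hx y hy hxy) (abs_nonneg _) ((abs_nonneg c).trans hc)

lemma add (hf : HolderBound α M R f) (hg : HolderBound α N R g) :
    HolderBound α (M + N) R fun x => f x + g x where
  nonneg := add_nonneg hf.nonneg hg.nonneg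
  bound x hx := (abs_add_le _ _).trans (add_le_add (hf.bound x hx) (hg.bound x hx))
  holder x hx y hy hxy := by
    rw [add_sub_add_comm, add_mul]
    exact (abs_add_le _ _).trans (add_le_add (hf.holder x hx y hy hxy) (hg.holder x hx y hy hxy))

lemma mul (hf : HolderBound α M R f) (hg : HolderBound α N R g) :
    HolderBound α (2 * (M * N)) R fun x => f x * g x where
  nonneg := mul_nonneg zero_le_two (mul_nonneg hf.nonneg hg.nonneg)
  bound x hx := by
    rw [abs_mul]
    have := mul_le_mul (hf.bound x hx) (hg.bound x hx) (abs_nonneg _) hf.nonneg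
    linarith [mul_nonneg hf.nonneg hg.nonneg]
  holder x hx y hy hxy := by
    have e : f x * g x - f y * g y = f x * (g x - g y) + (f x - f y) * g y := by ring
    rw [e]
    refine (abs_add_le _ _).trans ?_
    rw [abs_mul, abs_mul]
    have h1 := mul_le_mul (hf.bound x hx) (hg.holder x hx y hy hxy) (abs_nonneg _) hf.nonneg
    have h2 := mul_le_mul (hf.holder x hx y hy hxy) (hg.bound y hy) (abs_nonneg _)
      (mul_nonneg hf.nonneg (by positivity))
    linarith

lemma comp (hf : HolderBound α M R f) {φ : ℝ → ℝ} {s : Set ℝ} {γ L : ℝ} (hγ : 0 < γ)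
    (hL : 0 ≤ L) (hfs : ∀ x ∈ Metric.ball (0 : E n) R, f x ∈ s)
    (hφ : ∀ a ∈ s, |φ a| ≤ L) (hφ' : ∀ a ∈ s, ∀ b ∈ s, |φ a - φ b| ≤ L * |a - b| ^ γ) :
    HolderBound (α * γ) (L * (M ^ γ + 1)) R fun x => φ (f x) where
  nonneg := mul_nonneg hL (add_nonneg (Real.rpow_nonneg hf.nonneg _) zero_le_one)
  bound x hx := (hφ _ (hfs x hx)).trans
    (le_mul_of_one_le_right hL (le_add_of_nonneg_left (Real.rpow_nonneg hf.nonneg _)))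
  holder x hx y hy hxy := by
    refine (hφ' _ (hfs x hx) _ (hfs y hy)).trans ?_
    rw [mul_assoc]
    refine mul_le_mul_of_nonneg_left ?_ hL
    have h1 := Real.rpow_le_rpow (abs_nonneg _) (hf.holder x hx y hy hxy) hγ.le
    rw [Real.mul_rpow hf.nonneg (by positivity), ← Real.rpow_mul (norm_nonneg _)] at h1
    refine h1.trans (mul_le_mul_of_nonneg_right ?_ (by positivity))
    linarith

lemma norm_gradient (h : ∀ i, HolderBound α M R (pd i u)) (hM : 0 ≤ M) :
    HolderBound α (n * M) R fun x => ‖gradient u x‖ where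
  nonneg := by positivity
  bound x hx := by
    rw [abs_of_nonneg (norm_nonneg _)]
    refine (norm_le_sum_abs _).trans ?_
    refine (Finset.sum_le_sum fun i _ => ?_).trans (le_of_eq (a := ∑ _i : Fin n, M) (by simp))
    rw [gradient_apply]
    exact (h i).bound x hx
  holder x hx y hy hxy := by
    refine (abs_norm_sub_norm_le _ _).trans ?_
    refine (norm_le_sum_abs _).trans ?_
    refine (Finset.sum_le_sum fun i _ => ?_).trans
      (le_of_eq (a := ∑ _i : Fin n, M * ‖x - y‖ ^ α) (by simp; ring))
    rw [PiLp.sub_apply, gradient_apply, gradient_apply]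
    exact (h i).holder x hx y hy hxy

end HolderBound

lemma abs_sub_le_of_norm_gradient_le {s : Set (E n)} (hs : Convex ℝ s) {S : ℝ}
    (hu : ∀ x ∈ s, DifferentiableAt ℝ u x) (hS : ∀ x ∈ s, ‖gradient u x‖ ≤ S) {x y : E n}
    (hx : x ∈ s) (hy : y ∈ s) : |u x - u y| ≤ S * ‖x - y‖ :=
  hs.norm_image_sub_le_of_norm_fderiv_le hu
    (fun z hz => (norm_gradient_eq u z).symm.le.trans (hS z hz)) hy hx

/-- The pointwise equation `Δv + ν |∇v|² + a |∇v|^q e^{κ v} = 0`. -/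
def IsHJ (ν a κ q : ℝ) (v : E n → ℝ) (x : E n) : Prop :=
  elaplacian v x + ν * ‖gradient v x‖ ^ 2 + a * ‖gradient v x‖ ^ q * Real.exp (κ * v x) = 0

lemma HolderBound.of_deriv {α M Q R : ℝ} (hu : ContDiff ℝ 2 u) (hα0 : 0 < α)
    (hM : ∀ i, ∀ x ∈ Metric.ball (0 : E n) (R + 1), |pd i u x| ≤ M)
    (hP : ∀ i j, ∀ x ∈ Metric.ball (0 : E n) (R + 1), ∀ y ∈ Metric.ball (0 : E n) (R + 1),
      ‖x - y‖ ≤ 1 → |pd i (pd j u) x - pd i (pd j u) y| ≤ Q * ‖x - y‖ ^ α)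
    (hM0 : 0 ≤ M) (hQ : 0 ≤ Q) (i j : Fin n) :
    HolderBound α (2 * M + Q) R (pd i (pd j u)) where
  nonneg := by positivity
  holder x hx y hy hxy := by
    refine (hP i j x (Metric.ball_subset_ball (by linarith) hx) y
      (Metric.ball_subset_ball (by linarith) hy) hxy).trans ?_
    gcongr
    linarith
  bound x hx := by
    set e : E n := EuclideanSpace.single i 1 with he
    have hen : ‖e‖ = 1 := by simp [he]
    have hmem : ∀ s ∈ Icc (0 : ℝ) 1, x + s • e ∈ Metric.ball (0 : E n) (R + 1) := by
      intro s hs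
      rw [mem_ball_zero_iff] at *
      have h1 := norm_add_le x (s • e)
      rw [norm_smul, hen, mul_one, Real.norm_eq_abs, abs_of_nonneg hs.1] at h1
      linarith [hs.2]
    have hd : ∀ s : ℝ,
        HasDerivAt (fun s : ℝ => pd j u (x + s • e)) (pd i (pd j u) (x + s • e)) s := by
      intro s
      have h1 : HasDerivAt (fun s : ℝ => x + s • e) e s := by
        simpa using ((hasDerivAt_id s).smul_const e).const_add x
      exact (((contDiff_pd_one hu j).differentiable
        (by norm_num)) _).hasFDerivAt.comp_hasDerivAt s h1
    obtain ⟨s, hs, hs'⟩ := exists_hasDerivAt_eq_slope (fun s : ℝ => pd j u (x + s • e)) _ one_pos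
      (fun s _ => (hd s).continuousAt.continuousWithinAt) fun s _ => hd s
    have hs0 : s ∈ Icc (0 : ℝ) 1 := Ioo_subset_Icc_self hs
    have h1 := hM j _ (hmem 1 (by simp))
    have h2 := hM j _ (hmem 0 (by simp))
    have h3 := hP i j _ (hmem 0 (by simp)) _ (hmem s hs0) (by
      simp [norm_smul, hen, abs_of_nonneg hs0.1, hs0.2])
    rw [hs'] at h3
    simp only [zero_smul, add_zero, sub_zero, div_one] at h3
    have h4 : ‖x - (x + s • e)‖ ^ α ≤ 1 :=
      Real.rpow_le_one (norm_nonneg _) (by simp [norm_smul, hen, abs_of_nonneg hs0.1, hs0.2]) hα0.le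
    have h5 := mul_le_of_le_one_right hQ h4
    simp only [zero_smul, add_zero] at h2
    rw [abs_le] at *
    constructor <;> linarith [h1.1, h1.2, h2.1, h2.2, h3.1, h3.2]

/-- Interior `C^{2,α}` estimate for solutions with bounded gradient. -/
lemma exists_interior_estimate (hn : 0 < n) {q : ℝ} (hq : 0 ≤ q) :
    ∃ α : ℝ, 0 < α ∧ ∀ R S A : ℝ, 0 ≤ R → 0 ≤ S → ∃ C, ∀ (v : E n → ℝ) (ν a κ : ℝ),
      ContDiffOn ℝ 2 v (Metric.ball 0 (R + 4)) → v 0 = 0 →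
      (∀ x ∈ Metric.ball (0 : E n) (R + 4), ‖gradient v x‖ ≤ S) →
      (∀ x ∈ Metric.ball (0 : E n) (R + 4), IsHJ ν a κ q v x) →
      |ν| ≤ A → |a| ≤ A → |κ| ≤ A →
      (∀ x ∈ Metric.ball (0 : E n) R, |v x| ≤ C) ∧ (∀ i, HolderBound α C R (pd i v)) ∧
      ∀ i j, HolderBound α C R (pd i (pd j v)) := by
  obtain ⟨γ, hγ0, hγ1, hγ⟩ := exists_rpow_holder hq
  have hα0 : 0 < 1 / 2 * γ := by linarith
  have hα1 : 1 / 2 * γ < 1 := by linarith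
  obtain ⟨C₁, hC₁, hgrad⟩ := exists_gradient_holder hn
  obtain ⟨C₂, hC₂, hhess⟩ := exists_hessian_holder hn hα0 hα1
  refine ⟨1 / 2 * γ, hα0, fun R S A hR hS => ?_⟩
  obtain ⟨L, hL, hrpow⟩ := hγ S
  set P := S * (R + 3) with hP
  have hP0 : 0 ≤ P := by positivity
  set B := A * (P + S) with hB
  set Q := A * S ^ 2 + A * S ^ q * Real.exp B with hQ
  set G := S + C₁ * (P + Q) with hG
  set H := A * (2 * ((n * G) * (n * G))) + A * (2 * (((L + S ^ q) * ((n * G) ^ γ + 1))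
      * (Real.exp B * (B ^ (1 : ℝ) + 1)))) with hH
  refine ⟨P + G + (2 * S + C₂ * (P + H)), ?_⟩
  intro v ν a κ hv hv0 hS' hHJ hν ha hκ
  have hA : 0 ≤ A := (abs_nonneg _).trans hν
  have hB0 : 0 ≤ B := by positivity
  have hQ0 : 0 ≤ Q := by positivity
  have hG0 : 0 ≤ G := by positivity
  have hH0 : 0 ≤ H := by positivity
  obtain ⟨w, hw, hwv⟩ := exists_contDiff_eventuallyEq (R := R + 2) (by linarith)
    (show ContDiffOn ℝ 2 v (Metric.ball 0 (R + 2 + 2)) by convert hv using 2; ring)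
  rw [show R + 2 + 1 = R + 3 by ring] at hwv
  have hsub : ∀ x ∈ Metric.ball (0 : E n) (R + 3), x ∈ Metric.ball (0 : E n) (R + 4) :=
    fun x hx => Metric.ball_subset_ball (by linarith) hx
  have hw0 : w 0 = 0 := by
    rw [(hwv 0 (Metric.mem_ball_self (by linarith))).eq_of_nhds, hv0]
  have hwS : ∀ x ∈ Metric.ball (0 : E n) (R + 3), ‖gradient w x‖ ≤ S := fun x hx => by
    rw [norm_gradient_congr (hwv x hx)]
    exact hS' x (hsub x hx)
  have hwHJ : ∀ x ∈ Metric.ball (0 : E n) (R + 3), IsHJ ν a κ q w x := fun x hx => by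
    have := hHJ x (hsub x hx)
    rw [IsHJ] at *
    rwa [norm_gradient_congr (hwv x hx), elaplacian_congr (hwv x hx), (hwv x hx).eq_of_nhds]
  have hwlip : ∀ x ∈ Metric.ball (0 : E n) (R + 3), ∀ y ∈ Metric.ball (0 : E n) (R + 3),
      |w x - w y| ≤ S * ‖x - y‖ := fun x hx y hy =>
    abs_sub_le_of_norm_gradient_le (convex_ball _ _)
      (fun z _ => hw.differentiable (by norm_num) z) hwS hx hy
  have hwP : ∀ x ∈ Metric.ball (0 : E n) (R + 3), |w x| ≤ P := fun x hx => by
    have h1 := hwlip x hx 0 (Metric.mem_ball_self (by linarith))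
    rw [hw0, sub_zero, sub_zero] at h1
    rw [mem_ball_zero_iff] at hx
    exact h1.trans (mul_le_mul_of_nonneg_left hx.le hS)
  have hlap : ∀ x ∈ Metric.ball (0 : E n) (R + 3), elaplacian w x
      = (-ν) * (‖gradient w x‖ * ‖gradient w x‖)
        + (-a) * (‖gradient w x‖ ^ q * Real.exp (κ * w x)) := fun x hx => by
    have := hwHJ x hx
    rw [IsHJ] at this
    linear_combination this
  have hexpB : ∀ x ∈ Metric.ball (0 : E n) (R + 3), κ * w x ≤ B := fun x hx => by
    refine (le_abs_self _).trans ?_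
    rw [abs_mul]
    have := hwP x hx
    exact mul_le_mul hκ (by linarith) (abs_nonneg _) hA
  have hlapQ : ∀ x ∈ Metric.ball (0 : E n) (R + 3), |elaplacian w x| ≤ Q := fun x hx => by
    rw [hlap x hx]
    refine (abs_add_le _ _).trans ?_
    rw [abs_mul, abs_mul, abs_mul, abs_neg, abs_neg, abs_mul, abs_norm, Real.abs_exp,
      abs_of_nonneg (Real.rpow_nonneg (norm_nonneg _) _), hQ, sq, mul_assoc A (S ^ q)]
    have h1 := hwS x hx
    have h2 := hexpB x hx
    gcongr
  have e3 : R + 2 + 1 = R + 3 := by ring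
  have hpd : ∀ i, HolderBound (1 / 2) G (R + 2) (pd i w) := fun i =>
    { nonneg := hG0
      bound := fun x hx => by
        have := hwS x (Metric.ball_subset_ball (by linarith) hx)
        refine (abs_pd_le w x i).trans (this.trans ?_)
        rw [hG]
        have : 0 ≤ C₁ * (P + Q) := by positivity
        linarith
      holder := fun x hx y hy hxy => by
        refine (hgrad w (R + 2) P Q hw (by rwa [e3]) (by rwa [e3]) i x hx y hy hxy).trans ?_
        gcongr
        rw [hG]
        linarith }
  have hg := HolderBound.norm_gradient hpd hG0
  have hgα := hg.mono (α := 1 / 2 * γ) (by linarith) hα0 le_rfl le_rfl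
  have hgq := hg.comp (φ := fun s => s ^ q) (s := Icc 0 S) (L := L + S ^ q) hγ0 (by positivity)
    (fun x hx => ⟨norm_nonneg _, hwS x (Metric.ball_subset_ball (by linarith) hx)⟩)
    (fun s hs => by
      rw [abs_of_nonneg (Real.rpow_nonneg hs.1 _)]
      exact (Real.rpow_le_rpow hs.1 hs.2 hq).trans (by linarith))
    (fun s hs t ht => (hrpow s t hs.1 hs.2 ht.1 ht.2).trans (by
      gcongr
      linarith [Real.rpow_nonneg hS q]))
  have hκw : HolderBound (1 / 2 * γ) B (R + 2) fun x => κ * w x :=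
    HolderBound.const_mul (f := w)
    { nonneg := by positivity
      bound := fun x hx => (hwP x (Metric.ball_subset_ball (by linarith) hx)).trans (by linarith)
      holder := fun x hx y hy hxy => by
        refine (hwlip x (Metric.ball_subset_ball (by linarith) hx) y
          (Metric.ball_subset_ball (by linarith) hy)).trans ?_
        refine mul_le_mul (by linarith) ?_ (norm_nonneg _) (by positivity)
        conv_lhs => rw [← Real.rpow_one ‖x - y‖]
        exact Real.rpow_le_rpow_of_exponent_ge_of_imp (norm_nonneg _) hxy hα1.le
          fun _ h0 => absurd h0 one_ne_zero } hκ
  have hexp := hκw.comp (φ := Real.exp) (s := Iic B) (L := Real.exp B) (γ := 1) one_pos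
    (by positivity) (fun x hx => hexpB x (Metric.ball_subset_ball (by linarith) hx))
    (fun s hs => by rw [Real.abs_exp]; exact Real.exp_le_exp.2 hs)
    (fun s hs t ht => by
      rw [Real.rpow_one]
      exact Convex.norm_image_sub_le_of_norm_hasDerivWithin_le
        (fun r _ => (Real.hasDerivAt_exp r).hasDerivWithinAt)
        (fun r hr => by
          rw [Real.norm_eq_abs, Real.abs_exp]
          exact Real.exp_le_exp.2 hr) (convex_Iic B) ht hs)
  rw [mul_one] at hexp
  have hlapH : HolderBound (1 / 2 * γ) H (R + 2) (elaplacian w) :=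
    (((hgα.mul hgα).const_mul ((abs_neg ν).trans_le hν)).add
      ((hgq.mul hexp).const_mul ((abs_neg a).trans_le ha))).congr fun x hx =>
      (hlap x (Metric.ball_subset_ball (by linarith) hx)).symm
  have hHess := hhess w (R + 1) P H hw
    (fun x hx => hwP x (Metric.ball_subset_ball (by linarith) hx))
    (by rw [show R + 1 + 1 = R + 2 by ring]; exact hlapH.holder) hH0
  have hpp := HolderBound.of_deriv (R := R) hw hα0 (fun i x hx => (abs_pd_le w x i).trans
    (hwS x (Metric.ball_subset_ball (by linarith) hx))) hHess hS (by positivity)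
  have hC₂0 : 0 ≤ C₂ * (P + H) := by positivity
  have hwv' : ∀ x ∈ Metric.ball (0 : E n) R, w =ᶠ[𝓝 x] v := fun x hx =>
    hwv x (Metric.ball_subset_ball (by linarith) hx)
  refine ⟨fun x hx => ?_, fun i => ?_, fun i j => ?_⟩
  · rw [← (hwv' x hx).eq_of_nhds]
    exact (hwP x (Metric.ball_subset_ball (by linarith) hx)).trans (by linarith)
  · refine ((hpd i).mono (by linarith) hα0 (by linarith) (by linarith)).congr fun x hx => ?_
    exact (pd_congr (hwv' x hx) i).eq_of_nhds
  · refine ((hpp i j).mono le_rfl hα0 (by linarith) le_rfl).congr fun x hx => ?_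
    exact (pd_congr (pd_congr (hwv' x hx) j) i).eq_of_nhds

lemma exists_tendsto_of_eventually_abs_le (U : Ultrafilter ℕ) {s : ℕ → ℝ} {C : ℝ}
    (h : ∀ᶠ k in U, |s k| ≤ C) : ∃ l, Tendsto s U (𝓝 l) := by
  obtain ⟨l, -, hl⟩ := (isCompact_Icc (a := -C) (b := C)).ultrafilter_le_nhds (U.map s) (by
    rw [le_principal_iff, Ultrafilter.coe_map]
    exact h.mono fun k hk => abs_le.1 hk)
  exact ⟨l, hl⟩

/-- The continuous linear functional with the given coordinates. -/
noncomputable def coordForm (D : Fin n → ℝ) : E n →L[ℝ] ℝ :=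
  ∑ i, D i • (EuclideanSpace.proj i : E n →L[ℝ] ℝ)

lemma coordForm_apply (D : Fin n → ℝ) (v : E n) : coordForm D v = ∑ i, D i * v i := by
  simp [coordForm]

lemma fderiv_eq_coordForm (u : E n → ℝ) (x : E n) :
    fderiv ℝ u x = coordForm fun i => pd i u x := by
  ext v
  rw [fderiv_apply_eq_sum, coordForm_apply]
  simp only [mul_comm]

lemma norm_coordForm_le (D : Fin n → ℝ) : ‖coordForm D‖ ≤ ∑ i, |D i| := by
  refine ContinuousLinearMap.opNorm_le_bound _ (Finset.sum_nonneg fun _ _ => abs_nonneg _)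
    fun v => ?_
  rw [coordForm_apply, Finset.sum_mul]
  refine (norm_sum_le _ _).trans (Finset.sum_le_sum fun i _ => ?_)
  rw [norm_mul, Real.norm_eq_abs]
  exact mul_le_mul_of_nonneg_left (PiLp.norm_apply_le v i) (abs_nonneg _)

lemma coordForm_sub (D D' : Fin n → ℝ) :
    coordForm (fun i => D i - D' i) = coordForm D - coordForm D' := by
  ext v
  simp only [coordForm_apply, _root_.sub_apply, ← Finset.sum_sub_distrib, sub_mul]

lemma pd_eq_of_hasFDerivAt {D : Fin n → ℝ} {x : E n} (h : HasFDerivAt u (coordForm D) x)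
    (i : Fin n) : pd i u x = D i := by
  rw [pd, h.fderiv, coordForm_apply]
  simp

lemma contDiff_add_one_of_hasFDerivAt {m : ℕ} {D : Fin n → E n → ℝ}
    (h : ∀ x, HasFDerivAt u (coordForm fun i => D i x) x) (hD : ∀ i, ContDiff ℝ m (D i)) :
    ContDiff ℝ (m + 1) u := by
  rw [contDiff_succ_iff_fderiv]
  refine ⟨fun x => (h x).differentiableAt, by simp, ?_⟩
  have e : fderiv ℝ u = fun x => coordForm fun i => D i x := funext fun x => (h x).fderiv
  rw [e]
  exact ContDiff.sum fun i _ => (hD i).smul contDiff_const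

lemma HolderBound.abs_sub_sub_le {s : E n → ℝ} {R α C : ℝ}
    (hd : ∀ x ∈ Metric.ball (0 : E n) R, DifferentiableAt ℝ s x) (hα : 0 < α)
    (hC : ∀ i, HolderBound α C R (pd i s)) {x y : E n} (hx : x ∈ Metric.ball (0 : E n) R)
    (hy : y ∈ Metric.ball (0 : E n) R) (hxy : ‖y - x‖ ≤ 1) :
    |s y - s x - ∑ i, pd i s x * (y - x) i| ≤ n * C * ‖y - x‖ ^ α * ‖y - x‖ := by
  have h := Convex.norm_image_sub_le_of_norm_fderiv_le' (𝕜 := ℝ) (f := s)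
    (s := Metric.ball (0 : E n) R ∩ Metric.closedBall x ‖y - x‖) (x := x) (y := y)
    (φ := fderiv ℝ s x) (C := n * C * ‖y - x‖ ^ α) (fun z hz => hd z hz.1) (fun z hz => ?_)
    ((convex_ball _ _).inter (convex_closedBall _ _)) ⟨hx, by simp⟩ ⟨hy, by simp [dist_eq_norm]⟩
  · rwa [fderiv_eq_coordForm, coordForm_apply] at h
  · have hz2 : ‖z - x‖ ≤ ‖y - x‖ := by simpa [dist_eq_norm] using hz.2
    rw [fderiv_eq_coordForm, fderiv_eq_coordForm, ← coordForm_sub]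
    refine (norm_coordForm_le _).trans ((Finset.sum_le_sum fun i _ => ?_).trans
      (le_of_eq (a := ∑ _i : Fin n, C * ‖y - x‖ ^ α) (by simp; ring)))
    refine ((hC i).holder z hz.1 x hx (hz2.trans hxy)).trans ?_
    have := (hC i).nonneg
    gcongr

lemma hasFDerivAt_of_tendsto {U : Ultrafilter ℕ} {s : ℕ → E n → ℝ} {w : E n → ℝ}
    {D : Fin n → E n → ℝ} {R α C : ℝ} (hα : 0 < α)
    (hd : ∀ᶠ k in U, ∀ x ∈ Metric.ball (0 : E n) R, DifferentiableAt ℝ (s k) x)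
    (hC : ∀ᶠ k in U, ∀ i, HolderBound α C R (pd i (s k)))
    (hs : ∀ x, Tendsto (fun k => s k x) U (𝓝 (w x)))
    (hD : ∀ i x, Tendsto (fun k => pd i (s k) x) U (𝓝 (D i x))) {x : E n}
    (hx : x ∈ Metric.ball (0 : E n) R) : HasFDerivAt w (coordForm fun i => D i x) x := by
  rw [hasFDerivAt_iff_tendsto]
  have hlim : Tendsto (fun y : E n => n * C * ‖y - x‖ ^ α) (𝓝 x) (𝓝 0) := by
    have h1 : ContinuousAt (fun y : E n => n * C * ‖y - x‖ ^ α) x :=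
      continuousAt_const.mul ((by fun_prop : ContinuousAt (fun y : E n => ‖y - x‖) x).rpow_const
        (Or.inr hα.le))
    simpa [ContinuousAt, Real.zero_rpow hα.ne'] using h1
  refine squeeze_zero' (Eventually.of_forall fun y => by positivity) ?_ hlim
  filter_upwards [Metric.isOpen_ball.mem_nhds hx, Metric.closedBall_mem_nhds x one_pos]
    with y hy hy1
  rw [mem_closedBall_iff_norm] at hy1
  rcases eq_or_ne y x with rfl | hne
  · simp [Real.zero_rpow hα.ne']
  have hpos : 0 < ‖y - x‖ := norm_pos_iff.2 (sub_ne_zero.2 hne)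
  rw [inv_mul_le_iff₀ hpos, coordForm_apply, mul_comm ‖y - x‖]
  have ht : Tendsto (fun k => |s k y - s k x - ∑ i, pd i (s k) x * (y - x) i|) U
      (𝓝 |w y - w x - ∑ i, D i x * (y - x) i|) :=
    (((hs y).sub (hs x)).sub (tendsto_finsetSum _ fun i _ => (hD i x).mul_const _)).abs
  refine le_of_tendsto ht ?_
  filter_upwards [hd, hC] with k h1 h2
  exact HolderBound.abs_sub_sub_le h1 hα h2 hx hy hy1

lemma continuous_of_tendsto {U : Ultrafilter ℕ} {s : ℕ → E n → ℝ} {w : E n → ℝ} {α : ℝ}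
    (hα : 0 < α) (hC : ∀ R : ℝ, 0 ≤ R → ∃ C, ∀ᶠ k in U, HolderBound α C R (s k))
    (hs : ∀ x, Tendsto (fun k => s k x) U (𝓝 (w x))) : Continuous w := by
  refine continuous_iff_continuousAt.2 fun x => ?_
  obtain ⟨C, hC⟩ := hC (‖x‖ + 1) (by positivity)
  have hx : x ∈ Metric.ball (0 : E n) (‖x‖ + 1) := by simp
  rw [ContinuousAt, tendsto_iff_norm_sub_tendsto_zero]
  have hlim : Tendsto (fun y : E n => C * ‖y - x‖ ^ α) (𝓝 x) (𝓝 0) := by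
    have h1 : ContinuousAt (fun y : E n => C * ‖y - x‖ ^ α) x :=
      continuousAt_const.mul ((by fun_prop : ContinuousAt (fun y : E n => ‖y - x‖) x).rpow_const
        (Or.inr hα.le))
    simpa [ContinuousAt, Real.zero_rpow hα.ne'] using h1
  refine squeeze_zero' (Eventually.of_forall fun y => by positivity) ?_ hlim
  filter_upwards [Metric.isOpen_ball.mem_nhds hx, Metric.closedBall_mem_nhds x one_pos]
    with y hy hy1
  rw [mem_closedBall_iff_norm] at hy1
  refine le_of_tendsto ((hs y).sub (hs x)).norm ?_
  filter_upwards [hC] with k hk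
  exact hk.holder y hy x hx hy1

/-- Compactness of sequences of solutions with bounded gradients, along an ultrafilter. -/
lemma exists_limit_solution (hn : 0 < n) {q : ℝ} (hq : 0 ≤ q) (U : Ultrafilter ℕ) {R : ℕ → ℝ}
    (hR : Tendsto R U atTop) {v : ℕ → E n → ℝ} {ν a κ : ℕ → ℝ} {S ν₀ a₀ κ₀ : ℝ}
    (hv : ∀ᶠ k in U, ContDiffOn ℝ 2 (v k) (Metric.ball 0 (R k)) ∧ v k 0 = 0 ∧
      ∀ x ∈ Metric.ball (0 : E n) (R k), ‖gradient (v k) x‖ ≤ S ∧ IsHJ (ν k) (a k) (κ k) q (v k) x)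
    (hν : Tendsto ν U (𝓝 ν₀)) (ha : Tendsto a U (𝓝 a₀)) (hκ : Tendsto κ U (𝓝 κ₀)) :
    ∃ w : E n → ℝ, ContDiff ℝ 2 w ∧ w 0 = 0 ∧ (∀ x, IsHJ ν₀ a₀ κ₀ q w x) ∧
      (∀ x, ‖gradient w x‖ ≤ S) ∧
      (∀ x, Tendsto (fun k => ‖gradient (v k) x‖) U (𝓝 ‖gradient w x‖)) ∧
      ∀ x, Tendsto (fun k => v k x) U (𝓝 (w x)) := by
  obtain ⟨α, hα, hest⟩ := exists_interior_estimate hn hq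
  set A := |ν₀| + |a₀| + |κ₀| + 1 with hA
  have hbd : ∀ᶠ k in U, |ν k| ≤ A ∧ |a k| ≤ A ∧ |κ k| ≤ A := by
    have h (s : ℕ → ℝ) (s₀ : ℝ) (hs : Tendsto s U (𝓝 s₀)) (h0 : |s₀| < A) :
        ∀ᶠ k in U, |s k| ≤ A := hs.abs.eventually (ge_mem_nhds h0)
    have h1 := abs_nonneg ν₀
    have h2 := abs_nonneg a₀
    have h3 := abs_nonneg κ₀
    filter_upwards [h ν ν₀ hν (by linarith), h a a₀ ha (by linarith), h κ κ₀ hκ (by linarith)]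
      with k a b c using ⟨a, b, c⟩
  have hS : 0 ≤ S := by
    obtain ⟨k, hk, hk'⟩ := (hv.and (hR.eventually_gt_atTop 0)).exists
    exact (norm_nonneg _).trans (hk.2.2 0 (Metric.mem_ball_self hk')).1
  have hsm : ∀ r : ℝ, ∀ᶠ k in U, ∀ x ∈ Metric.ball (0 : E n) r, ContDiffAt ℝ 2 (v k) x := by
    intro r
    filter_upwards [hv, hR.eventually_ge_atTop r] with k hk hk' x hx
    exact hk.1.contDiffAt (Metric.isOpen_ball.mem_nhds (Metric.ball_subset_ball hk' hx))
  have hE : ∀ r : ℝ, 0 ≤ r → ∃ C, ∀ᶠ k in U, (∀ x ∈ Metric.ball (0 : E n) r, |v k x| ≤ C) ∧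
      (∀ i, HolderBound α C r (pd i (v k))) ∧ ∀ i j, HolderBound α C r (pd i (pd j (v k))) := by
    intro r hr
    obtain ⟨C, hC⟩ := hest r S A hr hS
    refine ⟨C, ?_⟩
    filter_upwards [hv, hbd, hR.eventually_ge_atTop (r + 4)] with k hk hk' hkR
    exact hC (v k) (ν k) (a k) (κ k) (hk.1.mono (Metric.ball_subset_ball hkR)) hk.2.1
      (fun x hx => (hk.2.2 x (Metric.ball_subset_ball hkR hx)).1)
      (fun x hx => (hk.2.2 x (Metric.ball_subset_ball hkR hx)).2) hk'.1 hk'.2.1 hk'.2.2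
  have hmem : ∀ x : E n, x ∈ Metric.ball (0 : E n) (‖x‖ + 1) := fun x => by simp
  have hw : ∀ x, ∃ l, Tendsto (fun k => v k x) U (𝓝 l) := fun x => by
    obtain ⟨C, hC⟩ := hE (‖x‖ + 1) (by positivity)
    exact exists_tendsto_of_eventually_abs_le U (hC.mono fun k hk => hk.1 x (hmem x))
  have hD : ∀ i x, ∃ l, Tendsto (fun k => pd i (v k) x) U (𝓝 l) := fun i x => by
    obtain ⟨C, hC⟩ := hE (‖x‖ + 1) (by positivity)
    exact exists_tendsto_of_eventually_abs_le U (hC.mono fun k hk => (hk.2.1 i).bound x (hmem x))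
  have hDD : ∀ i j x, ∃ l, Tendsto (fun k => pd i (pd j (v k)) x) U (𝓝 l) := fun i j x => by
    obtain ⟨C, hC⟩ := hE (‖x‖ + 1) (by positivity)
    exact exists_tendsto_of_eventually_abs_le U
      (hC.mono fun k hk => (hk.2.2 i j).bound x (hmem x))
  choose w hw using hw
  choose D hD using hD
  choose DD hDD using hDD
  have hwd : ∀ x, HasFDerivAt w (coordForm fun i => D i x) x := fun x => by
    obtain ⟨C, hC⟩ := hE (‖x‖ + 1) (by positivity)
    exact hasFDerivAt_of_tendsto hα ((hsm _).mono fun k hk y hy =>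
      (hk y hy).differentiableAt (by norm_num)) (hC.mono fun k hk => hk.2.1) hw hD (hmem x)
  have hDd : ∀ j x, HasFDerivAt (D j) (coordForm fun i => DD i j x) x := fun j x => by
    obtain ⟨C, hC⟩ := hE (‖x‖ + 1) (by positivity)
    exact hasFDerivAt_of_tendsto hα ((hsm _).mono fun k hk y hy =>
      (contDiffAt_pd (hk y hy) (m := 1) (by norm_num) j).differentiableAt (by norm_num))
      (hC.mono fun k hk i => hk.2.2 i j) (hD j) (fun i => hDD i j) (hmem x)
  have hDDc : ∀ i j, Continuous (DD i j) := fun i j =>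
    continuous_of_tendsto hα (fun r hr => by
      obtain ⟨C, hC⟩ := hE r hr
      exact ⟨C, hC.mono fun k hk => hk.2.2 i j⟩) (hDD i j)
  have hDc : ∀ j, ContDiff ℝ 1 (D j) := fun j => by
    have := contDiff_add_one_of_hasFDerivAt (m := 0) (hDd j)
      fun i => contDiff_zero.2 (hDDc i j)
    simpa using this
  have hwc : ContDiff ℝ 2 w := by
    have := contDiff_add_one_of_hasFDerivAt (m := 1) hwd (by simpa using hDc)
    norm_num at this
    exact this
  have hpd : ∀ i, pd i w = D i := fun i => funext fun x => pd_eq_of_hasFDerivAt (hwd x) i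
  have hpdd : ∀ i j, pd i (D j) = DD i j := fun i j =>
    funext fun x => pd_eq_of_hasFDerivAt (hDd j x) i
  have hgrad : ∀ x, Tendsto (fun k => ‖gradient (v k) x‖) U (𝓝 ‖gradient w x‖) := fun x => by
    simp only [norm_gradient_eq_sqrt, hpd]
    exact (tendsto_finsetSum _ fun i _ => (hD i x).pow 2).sqrt
  have hev : ∀ x : E n, ∀ᶠ k in U, ‖gradient (v k) x‖ ≤ S ∧ IsHJ (ν k) (a k) (κ k) q (v k) x := by
    intro x
    filter_upwards [hv, hR.eventually_ge_atTop (‖x‖ + 1)] with k hk hkR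
    exact hk.2.2 x (Metric.ball_subset_ball hkR (hmem x))
  refine ⟨w, hwc, ?_, fun x => ?_, fun x => ?_, hgrad, hw⟩
  · refine tendsto_nhds_unique (hw 0) (tendsto_const_nhds.congr' ?_)
    filter_upwards [hv] with k hk using hk.2.1.symm
  · have hlap : Tendsto (fun k => elaplacian (v k) x) U (𝓝 (elaplacian w x)) := by
      simp only [elaplacian_eq_sum_pd, hpd, hpdd]
      exact tendsto_finsetSum _ fun i _ => hDD i i x
    have h1 : Tendsto (fun k => elaplacian (v k) x + ν k * ‖gradient (v k) x‖ ^ 2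
        + a k * ‖gradient (v k) x‖ ^ q * Real.exp (κ k * v k x)) U
        (𝓝 (elaplacian w x + ν₀ * ‖gradient w x‖ ^ 2
        + a₀ * ‖gradient w x‖ ^ q * Real.exp (κ₀ * w x))) :=
      (hlap.add (hν.mul ((hgrad x).pow 2))).add
        ((ha.mul ((hgrad x).rpow_const (Or.inr hq))).mul ((hκ.mul (hw x)).rexp))
    refine tendsto_nhds_unique h1 (tendsto_const_nhds.congr' ?_)
    filter_upwards [hev x] with k hk using hk.2.symm
  · exact le_of_tendsto (hgrad x) ((hev x).mono fun k hk => hk.1)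

lemma tendsto_slope_of_hasStrictFDerivAt {F : E n → ℝ} {F' : E n →L[ℝ] ℝ} {x₀ : E n}
    (h : HasStrictFDerivAt F F' x₀) (e : E n) :
    Tendsto (fun p : E n × ℝ => p.2⁻¹ * (F (p.1 + p.2 • e) - F p.1)) (𝓝 x₀ ×ˢ 𝓝[>] 0)
      (𝓝 (F' e)) := by
  have hc : Tendsto (fun p : E n × ℝ => (p.1 + p.2 • e, p.1)) (𝓝 x₀ ×ˢ 𝓝[>] 0)
      (𝓝 (x₀, x₀)) := by
    have h1 : Continuous fun p : E n × ℝ => (p.1 + p.2 • e, p.1) := by fun_prop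
    have h2 := h1.tendsto (x₀, 0)
    simp only [zero_smul, add_zero] at h2
    refine h2.mono_left ?_
    rw [nhds_prod_eq]
    exact prod_mono le_rfl nhdsWithin_le_nhds
  have h3 := (h.isLittleO.comp_tendsto hc)
  have hpos : ∀ᶠ p : E n × ℝ in 𝓝 x₀ ×ˢ 𝓝[>] 0, 0 < p.2 :=
    tendsto_snd.eventually self_mem_nhdsWithin
  have h4 : (fun p : E n × ℝ => F (p.1 + p.2 • e) - F p.1 - p.2 * F' e)
      =o[𝓝 x₀ ×ˢ 𝓝[>] 0] fun p => p.2 := by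
    have h5 : (fun p : E n × ℝ => p.2 • e) =O[𝓝 x₀ ×ˢ 𝓝[>] 0] fun p => p.2 := by
      refine Asymptotics.IsBigO.of_bound ‖e‖ (Eventually.of_forall fun p => ?_)
      rw [norm_smul, mul_comm]
    refine Asymptotics.IsLittleO.trans_isBigO ?_ h5
    refine h3.congr (fun p => ?_) (fun p => ?_) <;> simp
  have h6 := h4.tendsto_div_nhds_zero.add_const (F' e)
  rw [zero_add] at h6
  refine h6.congr' ?_
  filter_upwards [hpos] with p hp
  field_simp
  ring

lemma contDiff_sum_sq {d : Fin n → E n → ℝ} (hd : ∀ i, ContDiff ℝ 2 (d i)) :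
    ContDiff ℝ 2 fun x => ∑ i, d i x * d i x :=
  ContDiff.sum fun i _ => (hd i).mul (hd i)

lemma elaplacian_sum_sq {d : Fin n → E n → ℝ} (hd : ∀ i, ContDiff ℝ 2 (d i)) (x : E n) :
    elaplacian (fun x => ∑ i, d i x * d i x) x
      = ∑ i, 2 * (∑ j, pd j (d i) x ^ 2 + d i x * elaplacian (d i) x) := by
  have hd1 : ∀ i, Differentiable ℝ (d i) := fun i => (hd i).differentiable (by norm_num)
  have hd2 : ∀ i j, Differentiable ℝ (pd j (d i)) := fun i j =>
    (contDiff_pd_one (hd i) j).differentiable (by norm_num)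
  have h1 : ∀ j, pd j (fun x => ∑ i, d i x * d i x) = fun x => ∑ i, 2 * (d i x * pd j (d i) x) := by
    intro j
    ext x
    rw [pd_sum fun i _ => ((hd1 i).fun_mul (hd1 i)) x]
    refine Finset.sum_congr rfl fun i _ => ?_
    rw [pd_mul (hd1 i x) (hd1 i x)]
    ring
  simp only [elaplacian_eq_sum_pd, h1]
  have h2 : ∀ j, pd j (fun x => ∑ i, 2 * (d i x * pd j (d i) x)) x
      = ∑ i, 2 * (pd j (d i) x ^ 2 + d i x * pd j (pd j (d i)) x) := by
    intro j
    rw [pd_sum fun i _ => (((hd1 i).fun_mul (hd2 i j)) x).const_mul 2]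
    refine Finset.sum_congr rfl fun i _ => ?_
    rw [pd_const_mul (((hd1 i).fun_mul (hd2 i j)) x), pd_mul (hd1 i x) (hd2 i j x)]
    ring
  simp only [h2]
  rw [Finset.sum_comm]
  refine Finset.sum_congr rfl fun i _ => ?_
  rw [← Finset.mul_sum, Finset.sum_add_distrib, ← Finset.mul_sum]

lemma add_le_avg_of_le_elaplacian {φ ψ : E n → ℝ} (h : IsPair 0 φ ψ) (hφ1 : ∫ z, φ z = 1)
    (hψ : ∀ z, 0 ≤ ψ z) {g : E n → ℝ} (hg : ContDiff ℝ 2 g) {x : E n} {c ρ : ℝ} (hρ : 0 < ρ)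
    (hc : ∀ y ∈ Metric.closedBall x ρ, c ≤ elaplacian g y) :
    g x + c * (∫ z, ψ z) * ρ ^ 2 / 2 ≤ avg φ ρ g x := by
  set c' := c * ∫ z, ψ z with hc'
  have hder : ∀ s, 0 < s → HasDerivAt (fun s => avg φ s g x) (s * avg ψ s (elaplacian g) x) s := by
    intro s hs
    simpa using h.hasDerivAt hg x hs
  have hder2 : ∀ s, 0 < s → HasDerivAt (fun s => avg φ s g x - c' * s ^ 2 / 2)
      (s * avg ψ s (elaplacian g) x - c' * s) s := fun s hs => by
    refine (hder s hs).sub (((hasDerivAt_pow 2 s).const_mul c').div_const 2 |>.congr_deriv ?_)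
    norm_num
    ring
  have h0 : avg φ 0 g x = g x := by
    simp [avg, integral_mul_const, hφ1]
  have hmono : MonotoneOn (fun s => avg φ s g x - c' * s ^ 2 / 2) (Icc 0 ρ) := by
    refine monotoneOn_of_deriv_nonneg (convex_Icc 0 ρ) (fun s hs => ?_) ?_ ?_
    · rcases hs.1.eq_or_lt with rfl | hs0
      · have h1 : ContinuousAt (fun s => avg φ s g x) 0 := by
          rw [ContinuousAt, h0]
          simpa [hφ1] using tendsto_avg_zero h.left hg.continuous x
        exact (h1.sub (by fun_prop)).continuousWithinAt
      · exact (hder2 s hs0).continuousAt.continuousWithinAt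
    · rw [interior_Icc]
      exact fun s hs => (hder2 s hs.1).differentiableAt.differentiableWithinAt
    · rw [interior_Icc]
      intro s hs
      rw [(hder2 s hs.1).deriv]
      have h2 : c' ≤ avg ψ s (elaplacian g) x := by
        have hcont : Continuous fun z : E n => elaplacian g (x + s • z) :=
          (continuous_elaplacian hg).comp (by fun_prop)
        rw [hc', ← integral_const_mul, avg]
        refine integral_mono (h.right.integrable.const_mul c) (h.right.integrable_mul hcont)
          fun z => ?_
        change c * ψ z ≤ ψ z * elaplacian g (x + s • z)
        rcases le_or_gt ‖z‖ 1 with hz | hz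
        · rw [mul_comm]
          refine mul_le_mul_of_nonneg_left (hc _ ?_) (hψ z)
          rw [mem_closedBall_iff_norm, add_sub_cancel_left, norm_smul, Real.norm_eq_abs,
            abs_of_pos hs.1]
          exact (mul_le_of_le_one_right hs.1.le hz).trans hs.2.le
        · simp [h.right.eq_zero hz]
      nlinarith [hs.1]
  have := hmono (left_mem_Icc.2 hρ.le) (right_mem_Icc.2 hρ.le) hρ.le
  simp only [h0] at this
  linarith

/-- If `|∇V|²` attains its maximum at a critical point of `ΔV`, then `ΔV` vanishes there. -/
lemma elaplacian_eq_zero_of_isMax (hn : 0 < n) {V : E n → ℝ} (hV : ContDiff ℝ 2 V) {x₀ : E n}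
    (hmax : ∀ x, ∑ i, pd i V x ^ 2 ≤ ∑ i, pd i V x₀ ^ 2)
    (hf : HasStrictFDerivAt (elaplacian V) (0 : E n →L[ℝ] ℝ) x₀) : elaplacian V x₀ = 0 := by
  by_contra hne
  obtain ⟨φ, ψ, hp, hφ, hψ, hφ1, hψ1⟩ := exists_mollifier_pair hn
  set e : Fin n → E n := fun i => EuclideanSpace.single i 1 with he
  set d : ℝ → Fin n → E n → ℝ := fun h i x => h⁻¹ * (V (x + h • e i) - V x) with hd
  have hV1 : Differentiable ℝ V := hV.differentiable (by norm_num)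
  have hVp : ∀ j, Differentiable ℝ (pd j V) := fun j =>
    (contDiff_pd_one hV j).differentiable (by norm_num)
  have hdC : ∀ h i, ContDiff ℝ 2 (d h i) := fun h i =>
    contDiff_const.mul ((hV.comp (contDiff_id.add contDiff_const)).sub hV)
  have hshift : ∀ (h : ℝ) (i j : Fin n) (W : E n → ℝ), Differentiable ℝ W → ∀ x,
      pd j (fun x => h⁻¹ * (W (x + h • e i) - W x)) x
        = h⁻¹ * (pd j W (x + h • e i) - pd j W x) := by
    intro h i j W hW x
    have h1 : Differentiable ℝ fun x => W (x + h • e i) := hW.comp (by fun_prop)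
    rw [pd_const_mul ((h1 x).fun_sub (hW x))]
    simp only [pd]
    rw [fderiv_fun_sub (h1 x) (hW x), fderiv_comp_add_right]
    simp
  have hdp : ∀ h i j, pd j (d h i) = fun x => h⁻¹ * (pd j V (x + h • e i) - pd j V x) :=
    fun h i j => funext fun x => hshift h i j V hV1 x
  have hdl : ∀ h i x, elaplacian (d h i) x
      = h⁻¹ * (elaplacian V (x + h • e i) - elaplacian V x) := by
    intro h i x
    simp only [elaplacian_eq_sum_pd]
    rw [← Finset.sum_sub_distrib, Finset.mul_sum]
    refine Finset.sum_congr rfl fun j _ => ?_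
    rw [hdp, hshift h i j _ (hVp j)]
  have hstrict : ∀ {W : E n → ℝ}, ContDiff ℝ 1 W → ∀ x, HasStrictFDerivAt W (fderiv ℝ W x) x :=
    fun hW x => hW.contDiffAt.hasStrictFDerivAt (by norm_num)
  set c := ∑ i, 2 * ∑ j, pd i (pd j V) x₀ ^ 2 with hc
  have hcpos : 0 < c := by
    obtain ⟨i, hi⟩ : ∃ i, pd i (pd i V) x₀ ≠ 0 := by
      by_contra! hcon
      exact hne (by rw [elaplacian_eq_sum_pd]; exact Finset.sum_eq_zero fun i _ => hcon i)
    refine Finset.sum_pos' (fun i _ => by positivity) ⟨i, Finset.mem_univ i, ?_⟩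
    refine mul_pos two_pos (Finset.sum_pos' (fun j _ => sq_nonneg _) ⟨i, Finset.mem_univ i, ?_⟩)
    positivity
  have hlim : Tendsto (fun p : E n × ℝ => elaplacian (fun x => ∑ i, d p.2 i x * d p.2 i x) p.1)
      (𝓝 x₀ ×ˢ 𝓝[>] 0) (𝓝 c) := by
    simp only [elaplacian_sum_sq (hdC _), hdl, hdp]
    have hcc : c = ∑ i, 2 * (∑ j, pd i (pd j V) x₀ ^ 2 + pd i V x₀ * 0) := by simp [hc]
    rw [hcc]
    refine tendsto_finsetSum _ fun i _ => Tendsto.const_mul _ (Tendsto.add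
      (tendsto_finsetSum _ fun j _ => Tendsto.pow ?_ 2) (Tendsto.mul ?_ ?_))
    · exact tendsto_slope_of_hasStrictFDerivAt (hstrict (contDiff_pd_one hV j) x₀) (e i)
    · exact tendsto_slope_of_hasStrictFDerivAt (hstrict (hV.of_le (by norm_num)) x₀) (e i)
    · simpa using tendsto_slope_of_hasStrictFDerivAt hf (e i)
  have hev := hlim.eventually (le_mem_nhds (half_lt_self hcpos))
  obtain ⟨A, hA, B, hB, hAB⟩ := eventually_prod_iff.1 hev
  obtain ⟨ρ, hρ, hρA⟩ := Metric.nhds_basis_closedBall.eventually_iff.1 hA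
  set S := √(∑ i, pd i V x₀ ^ 2) with hS
  have hgradS : ∀ x ∈ (univ : Set (E n)), ‖gradient V x‖ ≤ S := fun x _ => by
    rw [norm_gradient_eq_sqrt]
    exact Real.sqrt_le_sqrt (hmax x)
  have hdS : ∀ h, 0 < h → ∀ i x, |d h i x| ≤ S := by
    intro h hh i x
    have h1 := abs_sub_le_of_norm_gradient_le convex_univ (fun x _ => hV1 x) hgradS
      (mem_univ (x + h • e i)) (mem_univ x)
    have h2 : ‖h • e i‖ = h := by simp [he, norm_smul, abs_of_pos hh]
    rw [add_sub_cancel_left, h2] at h1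
    rw [abs_mul, abs_of_pos (inv_pos.2 hh), inv_mul_le_iff₀ hh, mul_comm h]
    exact h1
  have hgc : ∀ h, Continuous fun x => ∑ i, d h i x * d h i x := fun h =>
    (contDiff_sum_sq (hdC h)).continuous
  have hpt : ∀ x, Tendsto (fun h => ∑ i, d h i x * d h i x) (𝓝[>] 0) (𝓝 (∑ i, pd i V x ^ 2)) := by
    intro x
    simp only [sq]
    have h1 (i : Fin n) : Tendsto (fun h => d h i x) (𝓝[>] 0) (𝓝 (pd i V x)) :=
      (tendsto_slope_of_hasStrictFDerivAt (hstrict (hV.of_le (by norm_num)) x) (e i)).comp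
        ((tendsto_const_nhds (x := x)).prodMk tendsto_id)
    exact tendsto_finsetSum _ fun i _ => (h1 i).mul (h1 i)
  have hdct : Tendsto (fun h => avg φ ρ (fun x => ∑ i, d h i x * d h i x) x₀) (𝓝[>] 0)
      (𝓝 (avg φ ρ (fun x => ∑ i, pd i V x ^ 2) x₀)) := by
    refine tendsto_integral_filter_of_dominated_convergence (fun z => φ z * (n * (S * S)))
      (Eventually.of_forall fun h => ?_) ?_ (hp.left.integrable.mul_const _)
      (Eventually.of_forall fun z => (hpt _).const_mul _)
    · exact (hp.left.continuous.mul ((hgc h).comp (by fun_prop))).aestronglyMeasurable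
    · filter_upwards [self_mem_nhdsWithin] with h hh
      refine Eventually.of_forall fun z => ?_
      rw [norm_mul, Real.norm_eq_abs, abs_of_nonneg (hφ z)]
      refine mul_le_mul_of_nonneg_left ?_ (hφ z)
      refine (norm_sum_le _ _).trans ((Finset.sum_le_sum fun i _ => ?_).trans
        (le_of_eq (a := ∑ _i : Fin n, S * S) (by simp)))
      rw [norm_mul]
      exact mul_le_mul (hdS h hh i _) (hdS h hh i _) (abs_nonneg _) (Real.sqrt_nonneg _)
  have hineq : ∑ i, pd i V x₀ ^ 2 + c / 2 * (∫ z, ψ z) * ρ ^ 2 / 2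
      ≤ avg φ ρ (fun x => ∑ i, pd i V x ^ 2) x₀ := by
    refine le_of_tendsto_of_tendsto ((hpt x₀).add_const _) hdct ?_
    filter_upwards [hB] with h hh
    exact add_le_avg_of_le_elaplacian hp hφ1 hψ (contDiff_sum_sq (hdC h)) hρ
      fun y hy => hAB (hρA hy) hh
  have hupper : avg φ ρ (fun x => ∑ i, pd i V x ^ 2) x₀ ≤ ∑ i, pd i V x₀ ^ 2 := by
    have hc2 : Continuous fun x => ∑ i, pd i V x ^ 2 :=
      continuous_finsetSum _ fun i _ => (contDiff_pd_one hV i).continuous.pow 2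
    have h1 : ∫ z, φ z * ∑ i, pd i V x₀ ^ 2 = ∑ i, pd i V x₀ ^ 2 := by
      rw [integral_mul_const, hφ1, one_mul]
    rw [← h1]
    refine integral_mono (hp.left.integrable_mul (hc2.comp (by fun_prop)))
      (hp.left.integrable.mul_const _) fun z => mul_le_mul_of_nonneg_left (hmax _) (hφ z)
  have : 0 < c / 2 * (∫ z, ψ z) * ρ ^ 2 / 2 := by positivity
  linarith

lemma contDiffOn_comp_affine {s t : Set (E n)} (hu : ContDiffOn ℝ 2 u s) (r c μ : ℝ) (x₀ : E n)
    (h : MapsTo (fun y => x₀ + μ • y) t s) :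
    ContDiffOn ℝ 2 (fun y => r * (u (x₀ + μ • y) - c)) t := by
  have h1 : ContDiff ℝ 2 fun y : E n => x₀ + μ • y := by fun_prop
  exact contDiffOn_const.mul ((hu.comp h1.contDiffOn h).sub contDiffOn_const)

/-- Entire solutions of `ΔV + ν |∇V|² + a |∇V|^q = 0` with bounded gradient are constant. -/
lemma norm_gradient_eq_zero_of_entire (hn : 0 < n) {q : ℝ} (hq : 0 ≤ q) {V : E n → ℝ}
    (hV : ContDiff ℝ 2 V) {S ν a : ℝ} (hS : ∀ x, ‖gradient V x‖ ≤ S)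
    (hHJ : ∀ x, IsHJ ν a 0 q V x) (hν : 0 ≤ ν) (ha : 0 ≤ a) (hνa : 0 < ν + a) (x : E n) :
    ‖gradient V x‖ = 0 := by
  by_contra hx
  have hbdd : BddAbove (range fun x => ‖gradient V x‖) := ⟨S, by rintro _ ⟨y, rfl⟩; exact hS y⟩
  set M := sSup (range fun x => ‖gradient V x‖) with hM
  have hle : ∀ y, ‖gradient V y‖ ≤ M := fun y => le_csSup hbdd (mem_range_self y)
  have hMpos : 0 < M := lt_of_lt_of_le (lt_of_le_of_ne (norm_nonneg _) (Ne.symm hx)) (hle x)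
  obtain ⟨s, -, hs, hmem⟩ := exists_seq_tendsto_sSup (range_nonempty fun x => ‖gradient V x‖) hbdd
  choose y hy using hmem
  have hU : ((hyperfilter ℕ : Ultrafilter ℕ) : Filter ℕ) ≤ atTop := by
    rw [← Nat.cofinite_eq_atTop]
    exact hyperfilter_le_cofinite
  obtain ⟨W, hW, -, hWHJ, hWS, hWlim, -⟩ := exists_limit_solution hn hq (hyperfilter ℕ)
    (R := fun k => (k : ℝ)) (tendsto_natCast_atTop_atTop.mono_left hU)
    (v := fun k z => 1 * (V (y k + (1 : ℝ) • z) - V (y k))) (ν := fun _ => ν) (a := fun _ => a)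
    (κ := fun _ => 0) (S := M)
    (Eventually.of_forall fun k => by
      refine ⟨contDiffOn_comp_affine hV.contDiffOn 1 _ 1 (y k) (mapsTo_univ _ _), by simp,
        fun z _ => ?_⟩
      · have h1 := hHJ (y k + (1 : ℝ) • z)
        rw [IsHJ] at *
        rw [elaplacian_comp_affine, norm_gradient_comp_affine]
        simp only [zero_mul, mul_one, abs_one, one_mul, one_pow] at h1 ⊢
        exact ⟨hle _, h1⟩)
    tendsto_const_nhds tendsto_const_nhds tendsto_const_nhds
  have hW0 : ‖gradient W 0‖ = M := by
    refine tendsto_nhds_unique (hWlim 0) ?_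
    refine (hs.mono_left hU).congr fun k => ?_
    rw [norm_gradient_comp_affine, mul_one, abs_one, one_mul, smul_zero, add_zero]
    exact (hy k).symm
  set g : E n → ℝ := fun z => ∑ i, pd i W z ^ 2 with hg
  have hg1 : ContDiff ℝ 1 g := ContDiff.sum fun i _ => (contDiff_pd_one hW i).pow 2
  have hmax : ∀ z, g z ≤ g 0 := fun z => by
    simp only [hg, ← norm_gradient_sq, hW0]
    exact pow_le_pow_left₀ (norm_nonneg _) (hWS z) 2
  have hg0 : g 0 ≠ 0 := by
    simp only [hg, ← norm_gradient_sq, hW0]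
    positivity
  have hgs : HasStrictFDerivAt g (0 : E n →L[ℝ] ℝ) 0 := by
    have h1 := hg1.contDiffAt.hasStrictFDerivAt (x := 0) (by norm_num)
    rwa [IsLocalMax.fderiv_eq_zero (Eventually.of_forall hmax)] at h1
  have hlap : elaplacian W = fun z => -(ν * g z + a * g z ^ (q / 2)) := by
    ext z
    have h1 := hWHJ z
    have h2 : ‖gradient W z‖ ^ q = g z ^ (q / 2) := by
      simp only [hg, ← norm_gradient_sq]
      rw [← Real.rpow_natCast, ← Real.rpow_mul (norm_nonneg _)]
      congr 1
      push_cast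
      ring
    rw [IsHJ, h2, norm_gradient_sq, zero_mul, Real.exp_zero] at h1
    simp only [hg] at h1 ⊢
    linear_combination h1
  have hstrict : HasStrictFDerivAt (elaplacian W) (0 : E n →L[ℝ] ℝ) 0 := by
    rw [hlap]
    have h1 := (Real.hasStrictDerivAt_rpow_const_of_ne hg0 (q / 2)).comp_hasStrictFDerivAt 0 hgs
    have h2 := ((hgs.const_mul ν).add (h1.const_mul a)).neg
    rw [smul_zero, smul_zero, smul_zero, add_zero, neg_zero] at h2
    exact h2
  have hzero := elaplacian_eq_zero_of_isMax hn hW hmax hstrict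
  have h1 := hWHJ 0
  rw [IsHJ, hzero, hW0, zero_mul, Real.exp_zero, mul_one, zero_add] at h1
  have h2 : 0 ≤ ν * M ^ 2 := by positivity
  have h3 : 0 ≤ a * M ^ q := by positivity
  rcases hν.eq_or_lt with rfl | hν
  · have : 0 < a * M ^ q := mul_pos (by linarith) (Real.rpow_pos_of_pos hMpos q)
    linarith
  · have : 0 < ν * M ^ 2 := by positivity
    linarith

lemma norm_gradient_exp {z : E n → ℝ} {x : E n} (hz : DifferentiableAt ℝ z x) :
    ‖gradient (fun y => Real.exp (z y)) x‖ = Real.exp (z x) * ‖gradient z x‖ := by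
  rw [norm_gradient_eq, norm_gradient_eq, fderiv_exp hz, norm_smul, Real.norm_eq_abs, Real.abs_exp]

lemma elaplacian_exp {z : E n → ℝ} {x : E n} (hz : ContDiffAt ℝ 2 z x) :
    elaplacian (fun y => Real.exp (z y)) x
      = Real.exp (z x) * (elaplacian z x + ‖gradient z x‖ ^ 2) := by
  have hev : ∀ᶠ y in 𝓝 x, DifferentiableAt ℝ z y :=
    (hz.eventually (by simp)).mono fun y hy => hy.differentiableAt (by norm_num)
  rw [norm_gradient_sq, elaplacian_eq_sum_pd, elaplacian_eq_sum_pd, ← Finset.sum_add_distrib,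
    Finset.mul_sum]
  refine Finset.sum_congr rfl fun i _ => ?_
  have h1 : pd i (fun y => Real.exp (z y)) =ᶠ[𝓝 x] fun y => Real.exp (z y) * pd i z y := by
    filter_upwards [hev] with y hy
    simp [pd, fderiv_exp hy]
  have hz1 := hz.differentiableAt (by norm_num)
  rw [(pd_congr h1 i).eq_of_nhds, pd_mul hz1.exp
    ((contDiffAt_pd hz (m := 1) (by norm_num) i).differentiableAt (by norm_num)), h1.eq_of_nhds]
  ring

lemma norm_gradient_exp_rpow_mul {z : E n → ℝ} {x : E n} (hz : DifferentiableAt ℝ z x) (q r : ℝ) :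
    ‖gradient (fun y => Real.exp (z y)) x‖ ^ q * Real.exp (z x) ^ r
      = ‖gradient z x‖ ^ q * Real.exp ((q + r) * z x) := by
  rw [norm_gradient_exp hz, Real.mul_rpow (Real.exp_pos _).le (norm_nonneg _), ← Real.exp_mul,
    ← Real.exp_mul, mul_right_comm, ← Real.exp_add, mul_comm]
  congr 2
  ring

lemma isHJ_of_exp {z : E n → ℝ} {x : E n} (hz : ContDiffAt ℝ 2 z x) (p q : ℝ) :
    elaplacian (fun y => Real.exp (z y)) x
      + ‖gradient (fun y => Real.exp (z y)) x‖ ^ q * Real.exp (z x) ^ p = 0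
      ↔ IsHJ 1 1 (p + q - 1) q z x := by
  have hz1 := hz.differentiableAt (by norm_num)
  rw [norm_gradient_exp_rpow_mul hz1, elaplacian_exp hz, IsHJ,
    show (q + p) * z x = z x + (p + q - 1) * z x by ring, Real.exp_add]
  have e : Real.exp (z x) * (elaplacian z x + ‖gradient z x‖ ^ 2)
      + ‖gradient z x‖ ^ q * (Real.exp (z x) * Real.exp ((p + q - 1) * z x))
      = Real.exp (z x) * (elaplacian z x + 1 * ‖gradient z x‖ ^ 2
        + 1 * ‖gradient z x‖ ^ q * Real.exp ((p + q - 1) * z x)) := by ring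
  rw [e, mul_eq_zero]
  simp [Real.exp_ne_zero]

/-- The quantity `|∇v|² + a |∇v|^q e^{κ v}`. -/
noncomputable def energy (a κ q : ℝ) (v : E n → ℝ) (x : E n) : ℝ :=
  ‖gradient v x‖ ^ 2 + a * ‖gradient v x‖ ^ q * Real.exp (κ * v x)

lemma energy_eq_zero {ν a κ q : ℝ} {w : E n → ℝ}
    (hHJ : ∀ x, IsHJ ν a κ q w x) (h0 : ∀ x, ‖gradient w x‖ = 0) (x : E n) :
    energy a κ q w x = 0 := by
  have h1 : ∀ i, pd i w = fun _ => 0 := fun i => funext fun y =>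
    abs_eq_zero.1 (le_antisymm ((abs_pd_le w y i).trans (h0 y).le) (abs_nonneg _))
  have h2 : elaplacian w x = 0 := by
    rw [elaplacian_eq_sum_pd]
    refine Finset.sum_eq_zero fun i _ => ?_
    rw [h1]
    simp [pd]
  have h3 := hHJ x
  rw [IsHJ, h2, h0] at h3
  rw [energy, h0]
  linear_combination h3

/-- The weak Liouville property, in terms of the logarithm of the solution. -/
def LogLiouville (n : ℕ) (κ q : ℝ) : Prop :=
  ∀ w : E n → ℝ, ContDiff ℝ 2 w → (∀ x, IsHJ 1 1 κ q w x) → (∀ x, ‖gradient w x‖ ≤ 1) →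
    (∀ x, ‖gradient w x‖ ^ q * Real.exp (κ * w x) ≤ 1) → ∀ x y, w x = w y

lemma logLiouville_of_weakLiouville {p q : ℝ}
    (hWLiou : ∀ u : E n → ℝ,
      ContDiff ℝ 2 u → (∀ x, 0 < u x) →
      (∀ x, elaplacian u x + ‖gradient u x‖ ^ q * u x ^ p = 0) →
      (∀ x, ‖gradient u x‖ / u x ≤ 1) →
      (∀ x, ‖gradient u x‖ ^ q * u x ^ (p - 1) ≤ 1) →
      ∀ x y, u x = u y) : LogLiouville n (p + q - 1) q := by
  intro w hw hHJ h1 h2 x y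
  have hd : ∀ x, DifferentiableAt ℝ w x := fun x => hw.differentiable (by norm_num) x
  refine Real.exp_injective (hWLiou (fun y => Real.exp (w y)) hw.exp (fun x => Real.exp_pos _)
    (fun x => (isHJ_of_exp hw.contDiffAt p q).2 (hHJ x)) (fun x => ?_) (fun x => ?_) x y)
  · rw [norm_gradient_exp (hd x), mul_div_cancel_left₀ _ (Real.exp_ne_zero _)]
    exact h1 x
  · rw [norm_gradient_exp_rpow_mul (hd x)]
    refine le_of_eq_of_le ?_ (h2 x)
    congr 3
    ring

/-- Under the weak Liouville property, entire solutions of bounded energy of the rescaled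
equations are constant. -/
lemma LogLiouville.norm_gradient_eq_zero {κ q : ℝ} (h : LogLiouville n κ q) (hn : 0 < n)
    (hq : 0 ≤ q) {w : E n → ℝ} {a : ℝ} (ha : 0 ≤ a) (hw : ContDiff ℝ 2 w)
    (hHJ : ∀ x, IsHJ 1 a κ q w x) (hS : ∀ x, ‖gradient w x‖ ≤ 2)
    (hE : ∀ x, energy a κ q w x ≤ 4) (x : E n) : ‖gradient w x‖ = 0 := by
  by_cases haκ : a = 0 ∨ κ = 0
  · have h1 : ∀ x, IsHJ 1 a 0 q w x := fun x => by
      have := hHJ x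
      rcases haκ with rfl | rfl
      · simpa [IsHJ] using this
      · exact this
    exact norm_gradient_eq_zero_of_entire hn hq hw hS h1 zero_le_one ha (by linarith) x
  push Not at haκ
  have ha0 : 0 < a := lt_of_le_of_ne ha haκ.1.symm
  set c := Real.log (a / 4 * 2 ^ q) / κ with hc
  have hexp : (1 / 2 : ℝ) ^ q * Real.exp (κ * c) = a / 4 := by
    rw [hc, mul_div_cancel₀ _ haκ.2, Real.exp_log (by positivity), one_div,
      Real.inv_rpow zero_le_two]
    field_simp
  set z : E n → ℝ := fun y => 1 * (w (0 + (1 / 2 : ℝ) • y) - (-c)) with hz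
  have hzg : ∀ y, ‖gradient z y‖ = 1 / 2 * ‖gradient w (0 + (1 / 2 : ℝ) • y)‖ := fun y => by
    rw [hz, norm_gradient_comp_affine]
    norm_num
  have hzq : ∀ y, ‖gradient z y‖ ^ q * Real.exp (κ * z y) = 1 / 4 *
      (a * ‖gradient w (0 + (1 / 2 : ℝ) • y)‖ ^ q * Real.exp (κ * w (0 + (1 / 2 : ℝ) • y))) := by
    intro y
    rw [hzg, Real.mul_rpow (by norm_num) (norm_nonneg _), hz,
      show κ * (1 * (w (0 + (1 / 2 : ℝ) • y) - (-c))) = κ * w (0 + (1 / 2 : ℝ) • y) + κ * c by ring,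
      Real.exp_add]
    linear_combination (‖gradient w (0 + (1 / 2 : ℝ) • y)‖ ^ q
      * Real.exp (κ * w (0 + (1 / 2 : ℝ) • y))) * hexp
  have hconst := h z (contDiffOn_univ.1 (contDiffOn_comp_affine hw.contDiffOn 1 (-c) (1 / 2) 0
      (mapsTo_univ _ _)))
    (fun y => by
      have h1 := hHJ (0 + (1 / 2 : ℝ) • y)
      rw [IsHJ] at h1 ⊢
      rw [one_mul, one_mul, hzq, hzg, hz, elaplacian_comp_affine]
      linear_combination (1 / 4) * h1)
    (fun y => by
      rw [hzg]
      linarith [hS (0 + (1 / 2 : ℝ) • y)])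
    (fun y => by
      rw [hzq]
      have h1 := hE (0 + (1 / 2 : ℝ) • y)
      rw [energy] at h1
      linarith [sq_nonneg ‖gradient w (0 + (1 / 2 : ℝ) • y)‖])
  have hz0 : ‖gradient z ((2 : ℝ) • x)‖ = 0 := by
    have : z = fun _ => z 0 := funext fun y => hconst y 0
    rw [this, norm_gradient_eq]
    simp
  rw [hzg, zero_add, smul_smul] at hz0
  norm_num at hz0
  simpa using hz0

/-- Rescaling around a point where the energy is large compared with the distance. -/
lemma exists_rescaled_solution {κ q d k : ℝ} (hq : 0 ≤ q) {v : E n → ℝ} {x : E n} (hd : 0 < d)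
    (hk : 0 < k) (hv : ContDiffOn ℝ 2 v (Metric.ball x d))
    (hHJ : ∀ y ∈ Metric.ball x d, IsHJ 1 1 κ q v y)
    (hlarge : (4 * k) ^ 2 < energy 1 κ q v x * d ^ 2) :
    ∃ (a : ℝ) (w : E n → ℝ), 0 < a ∧ ContDiffOn ℝ 2 w (Metric.ball 0 k) ∧ w 0 = 0 ∧
      energy a κ q w 0 = 1 ∧
      ∀ y ∈ Metric.ball (0 : E n) k, IsHJ 1 a κ q w y ∧ energy a κ q w y ≤ 4 := by
  set N : E n → ℝ := fun y => √(energy 1 κ q v y) with hN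
  have hE0 : ∀ y, 0 ≤ energy 1 κ q v y := fun y => by
    rw [energy]
    positivity
  set ρ := d / 2 with hρ
  have hsub : Metric.closedBall x ρ ⊆ Metric.ball x d := Metric.closedBall_subset_ball (by linarith)
  have hNc : ContinuousOn N (Metric.closedBall x ρ) := fun y hy => by
    have hy' := hv.contDiffAt (Metric.isOpen_ball.mem_nhds (hsub hy))
    have hg := continuousAt_norm_gradient (hy'.of_le (by norm_num : (1 : WithTop ℕ∞) ≤ 2))
    exact ((hg.pow 2).add ((continuousAt_const.mul (hg.rpow_const (Or.inr hq))).mul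
      (continuousAt_const.mul hy'.continuousAt).rexp)).sqrt.continuousWithinAt
  obtain ⟨y₀, hy₀, hmax⟩ := (isCompact_closedBall x ρ).exists_isMaxOn
    ⟨x, Metric.mem_closedBall_self (by positivity)⟩
    (f := fun y => (ρ - ‖y - x‖) * N y) ((by fun_prop : Continuous fun y : E n =>
      ρ - ‖y - x‖).continuousOn.mul hNc)
  have hNx : 4 * k < N x * d := by
    have h1 : 4 * k < √(energy 1 κ q v x * d ^ 2) := Real.lt_sqrt_of_sq_lt hlarge
    rwa [Real.sqrt_mul (hE0 x), Real.sqrt_sq hd.le] at h1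
  have hFx := hmax (Metric.mem_closedBall_self (by positivity) : x ∈ Metric.closedBall x ρ)
  simp only [mem_ofPred_eq, sub_self, norm_zero, sub_zero] at hFx
  rw [mem_closedBall_iff_norm] at hy₀
  set r := (ρ - ‖y₀ - x‖) / 2 with hr
  have hrN : k < r * N y₀ := by
    rw [hr]
    nlinarith
  have hr0 : 0 < r := by
    by_contra hcon
    have : r * N y₀ ≤ 0 := mul_nonpos_of_nonpos_of_nonneg (not_lt.1 hcon) (Real.sqrt_nonneg _)
    linarith
  have hN0 : 0 < N y₀ := by
    by_contra hcon
    have : r * N y₀ ≤ 0 := mul_nonpos_of_nonneg_of_nonpos hr0.le (not_lt.1 hcon)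
    linarith
  have hball : ∀ y, ‖y - y₀‖ < r → y ∈ Metric.closedBall x ρ ∧ N y ≤ 2 * N y₀ := by
    intro y hy
    have h1 : ‖y - x‖ ≤ ‖y - y₀‖ + ‖y₀ - x‖ := norm_sub_le_norm_sub_add_norm_sub _ _ _
    have h2 : r ≤ ρ - ‖y - x‖ := by linarith
    have h3 : y ∈ Metric.closedBall x ρ := by
      rw [mem_closedBall_iff_norm]
      linarith
    refine ⟨h3, ?_⟩
    have h4 : (ρ - ‖y - x‖) * N y ≤ (ρ - ‖y₀ - x‖) * N y₀ := hmax h3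
    have h5 := mul_le_mul_of_nonneg_right h2 (Real.sqrt_nonneg (energy 1 κ q v y))
    have h6 : ρ - ‖y₀ - x‖ = 2 * r := by rw [hr]; ring
    rw [h6] at h4
    have h7 : r * N y ≤ r * (2 * N y₀) := by
      calc r * N y ≤ _ := h5
        _ ≤ _ := h4
        _ = _ := by ring
    exact le_of_mul_le_mul_left h7 hr0
  set l := (N y₀)⁻¹ with hl
  have hl0 : 0 < l := inv_pos.2 hN0
  have hlr : k * l < r := by
    rw [hl, ← div_eq_mul_inv, div_lt_iff₀ hN0]
    exact hrN
  have hmaps : ∀ y ∈ Metric.ball (0 : E n) k, ‖y₀ + l • y - y₀‖ < r := fun y hy => by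
    rw [mem_ball_zero_iff] at hy
    rw [add_sub_cancel_left, norm_smul, Real.norm_eq_abs, abs_of_pos hl0]
    nlinarith
  set a := Real.exp (κ * v y₀) * l ^ (2 - q) with ha
  set w : E n → ℝ := fun y => 1 * (v (y₀ + l • y) - v y₀) with hw
  have hwg : ∀ y, ‖gradient w y‖ = l * ‖gradient v (y₀ + l • y)‖ := fun y => by
    rw [hw, norm_gradient_comp_affine, one_mul, abs_of_pos hl0]
  have hwq : ∀ y, a * ‖gradient w y‖ ^ q * Real.exp (κ * w y)
      = l ^ 2 * (‖gradient v (y₀ + l • y)‖ ^ q * Real.exp (κ * v (y₀ + l • y))) := by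
    intro y
    have h1 : l ^ (2 - q) * l ^ q = l ^ 2 := by
      rw [← Real.rpow_add hl0, sub_add_cancel, Real.rpow_two]
    have h2 : Real.exp (κ * v (y₀ + l • y))
        = Real.exp (κ * v y₀) * Real.exp (κ * w y) := by
      rw [← Real.exp_add, hw]
      congr 1
      ring
    rw [hwg, Real.mul_rpow hl0.le (norm_nonneg _), ha, h2, ← h1]
    ring
  have hwE : ∀ y, energy a κ q w y = l ^ 2 * energy 1 κ q v (y₀ + l • y) := fun y => by
    rw [energy, energy, hwq, hwg]
    ring
  have hNsq : ∀ y, energy 1 κ q v y = N y ^ 2 := fun y => (Real.sq_sqrt (hE0 y)).symm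
  refine ⟨a, w, by positivity, ?_, by simp [hw], ?_, fun y hy => ⟨?_, ?_⟩⟩
  · exact contDiffOn_comp_affine hv _ _ _ _ fun y hy => hsub (hball _ (hmaps y hy)).1
  · rw [hwE, smul_zero, add_zero, hNsq, hl]
    field_simp
  · have h1 := hHJ _ (hsub (hball _ (hmaps y hy)).1)
    rw [IsHJ] at h1 ⊢
    rw [hwq, hwg, hw, elaplacian_comp_affine]
    linear_combination l ^ 2 * h1
  · rw [hwE, hNsq]
    have h1 := (hball _ (hmaps y hy)).2
    have h2 : l * N (y₀ + l • y) ≤ 2 := by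
      rw [hl, inv_mul_le_iff₀ hN0]
      linarith
    have h3 : 0 ≤ l * N (y₀ + l • y) := mul_nonneg hl0.le (Real.sqrt_nonneg _)
    nlinarith

lemma norm_gradient_le_two_of_energy_le {a κ q : ℝ} {v : E n → ℝ} {x : E n} (ha : 0 ≤ a)
    (h : energy a κ q v x ≤ 4) : ‖gradient v x‖ ≤ 2 := by
  have h1 : 0 ≤ a * ‖gradient v x‖ ^ q * Real.exp (κ * v x) := by positivity
  rw [energy] at h
  exact abs_le_of_sq_le_sq' (by linarith) zero_le_two |>.2

/-- Rescaling a solution whose gradient at the origin is small: the quadratic term becomes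
negligible. -/
lemma exists_rescaled_solution_of_small_gradient {a κ q : ℝ} (hq : 0 < q) (ha : 0 < a)
    {v : E n → ℝ} (hv : ContDiffOn ℝ 2 v (Metric.ball 0 1)) (hv0 : v 0 = 0)
    (hE0 : energy a κ q v 0 = 1)
    (hvb : ∀ y ∈ Metric.ball (0 : E n) 1, IsHJ 1 a κ q v y ∧ energy a κ q v y ≤ 4)
    (hs : ‖gradient v 0‖ ^ 2 ≤ 1 / 2) :
    ∃ (μ : ℝ) (V : E n → ℝ), 0 < μ ∧ μ ≤ 2 * ‖gradient v 0‖ ∧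
      ContDiffOn ℝ 2 V (Metric.ball 0 μ⁻¹) ∧ V 0 = 0 ∧ ‖gradient V 0‖ = 1 ∧
      ∀ y ∈ Metric.ball (0 : E n) μ⁻¹,
        ‖gradient V y‖ ≤ (8 * Real.exp (2 * |κ|)) ^ q⁻¹ ∧
        IsHJ (μ * ‖gradient v 0‖) 1 (κ * (μ * ‖gradient v 0‖)) q V y := by
  set s := ‖gradient v 0‖ with hsdef
  set b := a * s ^ q with hb
  have hsb : s ^ 2 + b = 1 := by
    rw [energy, hv0, mul_zero, Real.exp_zero, mul_one] at hE0
    exact hE0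
  have hb2 : 1 / 2 ≤ b := by linarith
  have hb0 : 0 < b := by linarith
  have hs0 : 0 < s := by
    refine lt_of_le_of_ne (norm_nonneg _) fun h => ?_
    rw [hb, ← h, Real.zero_rpow hq.ne', mul_zero] at hb0
    exact lt_irrefl _ hb0
  set μ := s / b with hμ
  have hμ0 : 0 < μ := div_pos hs0 hb0
  set V : E n → ℝ := fun y => (μ * s)⁻¹ * (v (0 + μ • y) - 0) with hV
  have hmaps : MapsTo (fun y : E n => 0 + μ • y) (Metric.ball 0 μ⁻¹) (Metric.ball 0 1) := by
    intro y hy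
    rw [mem_ball_zero_iff] at hy ⊢
    change ‖0 + μ • y‖ < 1
    rw [zero_add, norm_smul, Real.norm_eq_abs, abs_of_pos hμ0]
    calc μ * ‖y‖ < μ * μ⁻¹ := by gcongr
      _ = 1 := mul_inv_cancel₀ hμ0.ne'
  have hVg : ∀ y, ‖gradient V y‖ = s⁻¹ * ‖gradient v (0 + μ • y)‖ := fun y => by
    rw [hV, norm_gradient_comp_affine, abs_of_pos (by positivity)]
    congr 1
    field_simp
  have hVq : ∀ y, ‖gradient V y‖ ^ q = b⁻¹ * (a * ‖gradient v (0 + μ • y)‖ ^ q) := fun y => by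
    rw [hVg, Real.mul_rpow (by positivity) (norm_nonneg _), Real.inv_rpow hs0.le, hb]
    field_simp
  refine ⟨μ, V, hμ0, ?_, contDiffOn_comp_affine hv _ _ _ _ hmaps, by simp [hV, hv0], ?_,
    fun y hy => ⟨?_, ?_⟩⟩
  · rw [hμ, div_le_iff₀ hb0]
    nlinarith
  · rw [hVg, smul_zero, add_zero]
    exact inv_mul_cancel₀ hs0.ne'
  · rw [Real.le_rpow_inv_iff_of_pos (norm_nonneg _) (by positivity) hq, hVq]
    have hz := hmaps hy
    set z : E n := 0 + μ • y
    have h1 : |v z - v 0| ≤ 2 * ‖z - 0‖ := abs_sub_le_of_norm_gradient_le (convex_ball 0 1)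
      (fun x hx => (hv.contDiffAt (Metric.isOpen_ball.mem_nhds hx)).differentiableAt (by norm_num))
      (fun x hx => norm_gradient_le_two_of_energy_le ha.le (hvb x hx).2) hz
      (Metric.mem_ball_self one_pos)
    rw [hv0, sub_zero, sub_zero] at h1
    rw [mem_ball_zero_iff] at hz
    have h2 : -(κ * v z) ≤ 2 * |κ| := by
      refine (neg_le_abs _).trans ?_
      rw [abs_mul, mul_comm]
      exact mul_le_mul_of_nonneg_right (by linarith) (abs_nonneg _)
    have h3 : a * ‖gradient v z‖ ^ q * Real.exp (κ * v z) ≤ 4 := by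
      have h4 := (hvb z (mem_ball_zero_iff.2 hz)).2
      rw [energy] at h4
      linarith [sq_nonneg ‖gradient v z‖]
    have h5 : a * ‖gradient v z‖ ^ q ≤ 4 * Real.exp (2 * |κ|) := by
      calc a * ‖gradient v z‖ ^ q
          = a * ‖gradient v z‖ ^ q * Real.exp (κ * v z) * Real.exp (-(κ * v z)) := by
            rw [mul_assoc _ (Real.exp _), ← Real.exp_add, add_neg_cancel, Real.exp_zero, mul_one]
        _ ≤ 4 * Real.exp (2 * |κ|) := by gcongr
    rw [inv_mul_le_iff₀ hb0]
    nlinarith [Real.exp_pos (2 * |κ|)]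
  · have h1 := (hvb _ (hmaps hy)).1
    rw [IsHJ] at h1 ⊢
    have h2 : κ * (μ * s) * V y = κ * v (0 + μ • y) := by
      rw [hV]
      field_simp
      ring
    have h3 : (μ * s)⁻¹ * μ ^ 2 = b⁻¹ := by
      rw [hμ]
      field_simp
    have h4 : μ * s * (s⁻¹) ^ 2 = b⁻¹ := by
      rw [hμ]
      field_simp
    rw [h2, hVq, hVg, mul_pow, ← mul_assoc, h4, hV, elaplacian_comp_affine, h3]
    linear_combination b⁻¹ * h1

/-- Under the weak Liouville property there is no sequence of normalized solutions on balls
exhausting the space. -/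
lemma LogLiouville.false_of_blowup {κ q : ℝ} (h : LogLiouville n κ q) (hn : 0 < n) (hq : 0 ≤ q)
    {a : ℕ → ℝ} {v : ℕ → E n → ℝ} (ha : ∀ k, 0 < a k)
    (hv : ∀ k : ℕ, ContDiffOn ℝ 2 (v k) (Metric.ball 0 (k + 1))) (hv0 : ∀ k, v k 0 = 0)
    (hE0 : ∀ k, energy (a k) κ q (v k) 0 = 1)
    (hvb : ∀ k : ℕ, ∀ y ∈ Metric.ball (0 : E n) (k + 1),
      IsHJ 1 (a k) κ q (v k) y ∧ energy (a k) κ q (v k) y ≤ 4) : False := by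
  set U : Ultrafilter ℕ := hyperfilter ℕ
  have hU : (U : Filter ℕ) ≤ atTop := by
    rw [← Nat.cofinite_eq_atTop]
    exact hyperfilter_le_cofinite
  have hR : Tendsto (fun k : ℕ => (k : ℝ) + 1) U atTop :=
    (tendsto_natCast_atTop_atTop.atTop_add tendsto_const_nhds).mono_left hU
  have hs1 : ∀ k, ‖gradient (v k) 0‖ ^ 2 + a k * ‖gradient (v k) 0‖ ^ q = 1 := fun k => by
    have h1 := hE0 k
    rwa [energy, hv0, mul_zero, Real.exp_zero, mul_one] at h1
  by_cases hC : ∃ C, ∀ᶠ k in U, a k ≤ C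
  · obtain ⟨C, hC⟩ := hC
    obtain ⟨a₀, ha₀⟩ := exists_tendsto_of_eventually_abs_le U (C := C)
      (hC.mono fun k hk => by rwa [abs_of_pos (ha k)])
    have ha₀0 : 0 ≤ a₀ := ge_of_tendsto' ha₀ fun k => (ha k).le
    obtain ⟨w, hw, hw0, hwHJ, hwS, hwg, hwv⟩ := exists_limit_solution hn hq U hR (v := v)
      (ν := fun _ => 1) (a := a) (κ := fun _ => κ) (S := 2)
      (Eventually.of_forall fun k => ⟨hv k, hv0 k, fun x hx =>
        ⟨norm_gradient_le_two_of_energy_le (ha k).le (hvb k x hx).2, (hvb k x hx).1⟩⟩)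
      tendsto_const_nhds ha₀ tendsto_const_nhds
    have hE : ∀ x, Tendsto (fun k => energy (a k) κ q (v k) x) U (𝓝 (energy a₀ κ q w x)) :=
      fun x => ((hwg x).pow 2).add ((ha₀.mul ((hwg x).rpow_const (Or.inr hq))).mul
        ((hwv x).const_mul κ).rexp)
    have hE4 : ∀ x, energy a₀ κ q w x ≤ 4 := fun x => by
      refine le_of_tendsto (hE x) ?_
      filter_upwards [hR.eventually (eventually_gt_atTop ‖x‖)] with k hk
      exact (hvb k x (mem_ball_zero_iff.2 hk)).2
    have h1 : energy a₀ κ q w 0 = 1 :=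
      tendsto_nhds_unique (hE 0) (tendsto_const_nhds.congr fun k => (hE0 k).symm)
    rw [energy_eq_zero hwHJ (h.norm_gradient_eq_zero hn hq ha₀0 hw hwHJ hwS hE4)] at h1
    exact zero_ne_one h1
  · push Not at hC
    have haU : Tendsto a U atTop := tendsto_atTop.2 fun C => (hC C).mono fun k hk => hk.le
    have hq0 : 0 < q := by
      refine lt_of_le_of_ne hq fun h0 => ?_
      obtain ⟨k, hk⟩ := (haU.eventually (eventually_gt_atTop 1)).exists
      have h1 := hs1 k
      rw [← h0, Real.rpow_zero] at h1
      linarith [sq_nonneg ‖gradient (v k) 0‖]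
    set s : ℕ → ℝ := fun k => ‖gradient (v k) 0‖ with hs
    have hsU : Tendsto s U (𝓝 0) := by
      have h1 : Tendsto (fun k => (a k)⁻¹ ^ q⁻¹) U (𝓝 0) := by
        have h2 := (tendsto_inv_atTop_zero.comp haU).rpow_const (p := q⁻¹)
          (Or.inr (inv_nonneg.2 hq))
        rwa [Real.zero_rpow (inv_ne_zero hq0.ne')] at h2
      refine squeeze_zero (fun k => norm_nonneg _) (fun k => ?_) h1
      rw [Real.le_rpow_inv_iff_of_pos (norm_nonneg _) (inv_nonneg.2 (ha k).le) hq0,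
        ← one_div, le_div_iff₀ (ha k)]
      have h2 := hs1 k
      linarith [sq_nonneg ‖gradient (v k) 0‖]
    have hex : ∀ k, ∃ (μ : ℝ) (V : E n → ℝ), s k ^ 2 ≤ 1 / 2 → _ := fun k => by
      have h1 : Metric.ball (0 : E n) 1 ⊆ Metric.ball 0 (k + 1) :=
        Metric.ball_subset_ball (by linarith [(k.cast_nonneg : (0 : ℝ) ≤ k)])
      by_cases hk : s k ^ 2 ≤ 1 / 2
      · obtain ⟨μ, V, hV⟩ := exists_rescaled_solution_of_small_gradient hq0 (ha k)
          ((hv k).mono h1) (hv0 k) (hE0 k) (fun y hy => hvb k y (h1 hy)) hk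
        exact ⟨μ, V, fun _ => hV⟩
      · exact ⟨0, 0, fun h => absurd h hk⟩
    choose μ V hμV using hex
    have hsmall : ∀ᶠ k in U, s k ^ 2 ≤ 1 / 2 := by
      have h1 := hsU.pow 2
      exact h1.eventually (ge_mem_nhds (by norm_num))
    have hμ : Tendsto μ U (𝓝 0) := by
      have h1 := hsU.const_mul 2
      rw [mul_zero] at h1
      exact squeeze_zero' (hsmall.mono fun k hk => (hμV k hk).1.le)
        (hsmall.mono fun k hk => (hμV k hk).2.1) h1
    have hμR : Tendsto (fun k => (μ k)⁻¹) U atTop := tendsto_inv_nhdsGT_zero.comp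
      (tendsto_nhdsWithin_iff.2 ⟨hμ, hsmall.mono fun k hk => (hμV k hk).1⟩)
    have hμs : Tendsto (fun k => μ k * s k) U (𝓝 0) := by
      simpa using hμ.mul hsU
    obtain ⟨W, hW, -, hWHJ, hWS, hWg, -⟩ := exists_limit_solution hn hq U hμR (v := V)
      (ν := fun k => μ k * s k) (a := fun _ => 1) (κ := fun k => κ * (μ k * s k))
      (κ₀ := 0) (hsmall.mono fun k hk => (hμV k hk).2.2.imp id (And.imp id And.right))
      hμs tendsto_const_nhds (by simpa using hμs.const_mul κ)
    have h1 : ‖gradient W 0‖ = 1 := tendsto_nhds_unique (hWg 0)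
      (tendsto_const_nhds.congr' (hsmall.mono fun k hk => (hμV k hk).2.2.2.2.1.symm))
    rw [norm_gradient_eq_zero_of_entire hn hq hW hWS hWHJ le_rfl zero_le_one (by norm_num)] at h1
    exact zero_ne_one h1

lemma infDist_frontier_pos {Ω : Set (E n)} (hΩ : IsOpen Ω) (hne : (frontier Ω).Nonempty) {x : E n}
    (hx : x ∈ Ω) : 0 < Metric.infDist x (frontier Ω) := by
  refine (isClosed_frontier.notMem_iff_infDist_pos hne).1 fun h => ?_
  rw [hΩ.frontier_eq] at h
  exact h.2 hx

lemma ball_infDist_frontier_subset {Ω : Set (E n)} (hΩ : IsOpen Ω)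
    (hne : (frontier Ω).Nonempty) {x : E n} (hx : x ∈ Ω) :
    Metric.ball x (Metric.infDist x (frontier Ω)) ⊆ Ω := by
  refine (convex_ball x _).isPreconnected.subset_of_closure_inter_subset hΩ
    ⟨x, Metric.mem_ball_self (infDist_frontier_pos hΩ hne hx), hx⟩ fun y hy => ?_
  by_contra hyΩ
  have hyf : y ∈ frontier Ω := by
    rw [hΩ.frontier_eq]
    exact ⟨hy.1, hyΩ⟩
  have hyb := Metric.mem_ball'.1 hy.2
  exact absurd (Metric.infDist_le_dist_of_mem hyf) (not_le.2 hyb)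

lemma isHJ_log_and_energy_log {Ω : Set (E n)} (hΩ : IsOpen Ω) {p q : ℝ}
    (hu : ContDiffOn ℝ 2 u Ω) (hpos : ∀ x ∈ Ω, 0 < u x)
    (heq : ∀ x ∈ Ω, elaplacian u x + ‖gradient u x‖ ^ q * u x ^ p = 0) {x : E n} (hx : x ∈ Ω) :
    IsHJ 1 1 (p + q - 1) q (fun y => Real.log (u y)) x ∧
      energy 1 (p + q - 1) q (fun y => Real.log (u y)) x
        = ‖gradient u x‖ ^ 2 / u x ^ 2 + ‖gradient u x‖ ^ q * u x ^ (p - 1) := by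
  have hnh := hΩ.mem_nhds hx
  have hz : ContDiffAt ℝ 2 (fun y => Real.log (u y)) x := (hu.contDiffAt hnh).log (hpos x hx).ne'
  have hz1 := hz.differentiableAt (by norm_num)
  have hev : (fun y => Real.exp (Real.log (u y))) =ᶠ[𝓝 x] u := by
    filter_upwards [hnh] with y hy
    exact Real.exp_log (hpos y hy)
  have hg := norm_gradient_congr hev
  constructor
  · rw [← isHJ_of_exp hz, elaplacian_congr hev, hg, hev.eq_of_nhds]
    exact heq x hx
  · have h1 := norm_gradient_exp_rpow_mul hz1 q (p - 1)
    have h2 := norm_gradient_exp hz1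
    have hux := hpos x hx
    rw [hg, hev.eq_of_nhds] at h1 h2
    rw [h1, h2, energy, show q + (p - 1) = p + q - 1 by ring, mul_pow,
      mul_div_cancel_left₀ _ (by positivity), one_mul]

end WeakLiouville

open WeakLiouville in
/-- **Theorem 8.1.** If the *weak* Liouville property holds for `(p,q)` in dimension `n`
(i.e. every positive entire solution with `|∇u|/u ≤ 1` and `|∇u|^q u^(p−1) ≤ 1` is
constant), then there is `C = C(n,p,q) > 0` such that every positive classical solution
of `Δu + |∇u|^q u^p = 0` on a domain `Ω ⊊ ℝⁿ` satisfies
`|∇u|²/u² + |∇u|^q u^(p−1) ≤ C / dist(x, ∂Ω)²` on `Ω`. -/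
theorem gradient_estimate_of_weak_liouville (n : ℕ) (hn : 2 ≤ n) (p q : ℝ) (hq : 0 ≤ q)
    (hWLiou : ∀ u : EuclideanSpace ℝ (Fin n) → ℝ,
      ContDiff ℝ 2 u → (∀ x, 0 < u x) →
      (∀ x, elaplacian u x + ‖gradient u x‖ ^ q * u x ^ p = 0) →
      (∀ x, ‖gradient u x‖ / u x ≤ 1) →
      (∀ x, ‖gradient u x‖ ^ q * u x ^ (p - 1) ≤ 1) →
      ∀ x y, u x = u y) :
    ∃ C > (0 : ℝ), ∀ Ω : Set (EuclideanSpace ℝ (Fin n)),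
      IsOpen Ω → IsConnected Ω → Ω ≠ Set.univ → (frontier Ω).Nonempty →
      ∀ u : EuclideanSpace ℝ (Fin n) → ℝ,
        ContDiffOn ℝ 2 u Ω → (∀ x ∈ Ω, 0 < u x) →
        (∀ x ∈ Ω, elaplacian u x + ‖gradient u x‖ ^ q * u x ^ p = 0) →
        ∀ x ∈ Ω,
          ‖gradient u x‖ ^ 2 / u x ^ 2 + ‖gradient u x‖ ^ q * u x ^ (p - 1)
            ≤ C / Metric.infDist x (frontier Ω) ^ 2 := by
  by_contra! hcon
  have hn0 : 0 < n := by lia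
  have hseq : ∀ k : ℕ, ∃ (a : ℝ) (w : EuclideanSpace ℝ (Fin n) → ℝ), 0 < a ∧
      ContDiffOn ℝ 2 w (Metric.ball 0 ((k : ℝ) + 1)) ∧ w 0 = 0 ∧
      energy a (p + q - 1) q w 0 = 1 ∧
      ∀ y ∈ Metric.ball (0 : EuclideanSpace ℝ (Fin n)) ((k : ℝ) + 1),
        IsHJ 1 a (p + q - 1) q w y ∧ energy a (p + q - 1) q w y ≤ 4 := by
    intro k
    obtain ⟨Ω, hΩ, -, -, hne, u, hu, hpos, heq, x, hx, hlarge⟩ :=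
      hcon ((4 * ((k : ℝ) + 1)) ^ 2) (by positivity)
    have hd := infDist_frontier_pos hΩ hne hx
    have hsub := ball_infDist_frontier_subset hΩ hne hx
    rw [← (isHJ_log_and_energy_log hΩ hu hpos heq hx).2, div_lt_iff₀ (by positivity)] at hlarge
    exact exists_rescaled_solution hq hd (by positivity)
      ((hu.log fun y hy => (hpos y hy).ne').mono hsub)
      (fun y hy => (isHJ_log_and_energy_log hΩ hu hpos heq (hsub hy)).1) hlarge
  choose a w ha hw hw0 hE0 hwb using hseq
  exact (logLiouville_of_weakLiouville hWLiou).false_of_blowup hn0 hq ha hw hw0 hE0 hwb
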